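/- arXiv:math/0210485 — 2 statements merged into one kernel-verified Lean document; each statement's English description precedes it below -/
import Mathlib

section
/- Let H₀, H₁, H₂ be complex Hilbert spaces and let T : H₀ → H₁ and S : H₁ → H₂ be closed, densely defined linear operators with Ran T ⊆ Ker S. Assume the compactness property: every sequence (u_k) in Dom S ∩ Dom T* with sup_k ‖u_k‖ < ∞, ‖S u_k‖ → 0 and ‖T* u_k‖ → 0 has a subsequence converging in H₁. Define Δ with domain Dom Δ = {u ∈ Dom S ∩ Dom T* : Su ∈ Dom S*, T*u ∈ Dom T} by Δu = S*(Su) + T(T*u), let ℋ = Ker S ∩ Ker T*, and let P : H₁ → H₁ be the orthogonal projection onto ℋ. Then there exists a bounded linear operator N : H₁ → H₁ (the Neumann operator) such that: N(H₁) ⊆ Dom Δ; Δ(Nu) = u − Pu for every u ∈ H₁; N(Δu) = u − Pu for every u ∈ Dom Δ; and P∘N = N∘P = 0. -/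
open Filter

variable {H₀ H₁ H₂ : Type*}
  [NormedAddCommGroup H₀] [InnerProductSpace ℂ H₀] [CompleteSpace H₀]
  [NormedAddCommGroup H₁] [InnerProductSpace ℂ H₁] [CompleteSpace H₁]
  [NormedAddCommGroup H₂] [InnerProductSpace ℂ H₂] [CompleteSpace H₂]

/-- The compactness property for the pair `(T, S)`:  every sequence `uₖ` in
`Dom S ∩ Dom T.adjoint` which is bounded in `H₁` and satisfies `‖S uₖ‖ → 0` and
`‖T.adjoint uₖ‖ → 0` admits a norm-convergent subsequence.  Membership in the domain together
with the value of the operator is encoded via graphs: `(u, s) ∈ S.graph` means `u ∈ Dom S` and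
`S u = s`. -/
def CompactnessProperty (T : H₀ →ₗ.[ℂ] H₁) (S : H₁ →ₗ.[ℂ] H₂) : Prop :=
  ∀ (u : ℕ → H₁) (s : ℕ → H₂) (t : ℕ → H₀),
    (∀ k, (u k, s k) ∈ S.graph) → (∀ k, (u k, t k) ∈ T.adjoint.graph) →
    (∃ M : ℝ, ∀ k, ‖u k‖ ≤ M) →
    Tendsto (fun k => ‖s k‖) atTop (nhds 0) →
    Tendsto (fun k => ‖t k‖) atTop (nhds 0) →
    ∃ (φ : ℕ → ℕ) (L : H₁), StrictMono φ ∧ Tendsto (u ∘ φ) atTop (nhds L)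

/-- The harmonic space `ℋ = Ker S ∩ Ker T*` as a subspace of `H₁`:
`u ∈ ℋ` iff `(u, 0) ∈ S.graph` (i.e. `u ∈ Dom S` and `S u = 0`) and `(u, 0) ∈ T.adjoint.graph`
(i.e. `u ∈ Dom T*` and `T* u = 0`). -/
noncomputable def harmonicSpace (T : H₀ →ₗ.[ℂ] H₁) (S : H₁ →ₗ.[ℂ] H₂) : Submodule ℂ H₁ :=
  (S.graph.comap ((LinearMap.id : H₁ →ₗ[ℂ] H₁).prod (0 : H₁ →ₗ[ℂ] H₂))) ⊓
  (T.adjoint.graph.comap ((LinearMap.id : H₁ →ₗ[ℂ] H₁).prod (0 : H₁ →ₗ[ℂ] H₀)))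

/-- The graph of the Laplacian `Δ = S* S + T T*`:  `(u, w) ∈ lapGraph T S` iff
`u ∈ Dom S ∩ Dom T*`, `S u ∈ Dom S*`, `T* u ∈ Dom T` and `w = S* (S u) + T (T* u)`. -/
noncomputable def lapGraph (T : H₀ →ₗ.[ℂ] H₁) (S : H₁ →ₗ.[ℂ] H₂) : Set (H₁ × H₁) :=
  {p : H₁ × H₁ | ∃ (a : H₂) (b : H₀) (c d : H₁),
    (p.1, a) ∈ S.graph ∧ (a, c) ∈ S.adjoint.graph ∧
    (p.1, b) ∈ T.adjoint.graph ∧ (b, d) ∈ T.graph ∧ p.2 = c + d}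

open scoped InnerProductSpace

namespace LinearPMap

variable {𝕜 E F : Type*} [RCLike 𝕜] [NormedAddCommGroup E] [InnerProductSpace 𝕜 E]
  [NormedAddCommGroup F] [InnerProductSpace 𝕜 F] [CompleteSpace E]

theorem mem_graph_adjoint_iff {T : E →ₗ.[𝕜] F} (hT : Dense (T.domain : Set E)) {y : F} {z : E} :
    (y, z) ∈ T.adjoint.graph ↔ ∀ x w, (x, w) ∈ T.graph → ⟪w, y⟫_𝕜 = ⟪x, z⟫_𝕜 := by
  rw [adjoint_graph_eq_graph_adjoint hT, Submodule.mem_adjoint_iff]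
  simp only [sub_eq_zero]

/-- A pair formally adjoint to the adjoint of a closed operator lies in its graph (`T†† ≤ T`). -/
theorem IsClosed.mem_graph_of_adjoint [CompleteSpace F] {T : E →ₗ.[𝕜] F} (hT : T.IsClosed)
    (hTd : Dense (T.domain : Set E)) {x : E} {w : F}
    (h : ∀ y z, (y, z) ∈ T.adjoint.graph → ⟪x, z⟫_𝕜 = ⟪w, y⟫_𝕜) : (x, w) ∈ T.graph := by
  let G : Submodule 𝕜 (WithLp 2 (E × F)) :=
    T.graph.comap (WithLp.linearEquiv 2 𝕜 (E × F) : WithLp 2 (E × F) →ₗ[𝕜] E × F)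
  have hG : _root_.IsClosed (G : Set (WithLp 2 (E × F))) :=
    IsClosed.preimage (WithLp.prod_continuous_ofLp 2 E F) hT
  have : CompleteSpace G := hG.completeSpace_coe
  suffices WithLp.toLp 2 (x, w) ∈ Gᗮᗮ by
    rw [Submodule.orthogonal_orthogonal] at this
    exact this
  rw [Submodule.mem_orthogonal']
  intro p hp
  rw [Submodule.mem_orthogonal] at hp
  have hp' : (p.snd, -p.fst) ∈ T.adjoint.graph := by
    rw [mem_graph_adjoint_iff hTd]
    intro a b hab
    have := hp (WithLp.toLp 2 (a, b)) hab
    rw [WithLp.prod_inner_apply] at this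
    simp only [inner_neg_right]
    exact eq_neg_of_add_eq_zero_right this
  have := h _ _ hp'
  rw [WithLp.prod_inner_apply]
  simp only [inner_neg_right] at this
  change ⟪x, p.fst⟫_𝕜 + ⟪w, p.snd⟫_𝕜 = 0
  rw [← this, add_neg_cancel]

end LinearPMap

namespace Submodule

variable {𝕜 E F : Type*} [RCLike 𝕜] [NormedAddCommGroup E] [NormedAddCommGroup F]

/-- A closed linear relation whose approximate kernel sequences are precompact and whose kernel is
trivial is bounded below. -/
theorem exists_bound_of_precompact [NormedSpace 𝕜 E] [NormedSpace 𝕜 F] {G : Submodule 𝕜 (E × F)}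
    (hG : IsClosed (G : Set (E × F))) (hker : ∀ u, (u, (0 : F)) ∈ G → u = 0)
    (hcpt : ∀ (u : ℕ → E) (e : ℕ → F), (∀ k, (u k, e k) ∈ G) → (∃ M : ℝ, ∀ k, ‖u k‖ ≤ M) →
      Tendsto e atTop (nhds 0) →
      ∃ (φ : ℕ → ℕ) (L : E), StrictMono φ ∧ Tendsto (u ∘ φ) atTop (nhds L)) :
    ∃ C : ℝ, ∀ u e, (u, e) ∈ G → ‖u‖ ≤ C * ‖e‖ := by
  by_contra! h
  have unit (k : ℕ) : ∃ p : E × F, p ∈ G ∧ ‖p.1‖ = 1 ∧ ‖p.2‖ ≤ 1 / ((k : ℝ) + 1) := by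
    obtain ⟨u, e, hue, hlt⟩ := h ((k : ℝ) + 1)
    have hk : (0 : ℝ) < k + 1 := by positivity
    have hu : 0 < ‖u‖ := (by positivity : 0 ≤ ((k : ℝ) + 1) * ‖e‖).trans_lt hlt
    have hc : ‖((‖u‖⁻¹ : ℝ) : 𝕜)‖ = ‖u‖⁻¹ := by simp
    refine ⟨((‖u‖⁻¹ : ℝ) : 𝕜) • (u, e), G.smul_mem _ hue, ?_, ?_⟩
    · rw [Prod.smul_fst, norm_smul, hc, inv_mul_cancel₀ hu.ne']
    · rw [Prod.smul_snd, norm_smul, hc, inv_mul_eq_div, div_le_div_iff₀ hu hk]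
      linarith
  choose p hpG hp1 hp2 using unit
  have he : Tendsto (fun k => (p k).2) atTop (nhds 0) :=
    squeeze_zero_norm hp2 tendsto_one_div_add_atTop_nhds_zero_nat
  obtain ⟨φ, L, hφ, hL⟩ := hcpt (fun k => (p k).1) (fun k => (p k).2) hpG
    ⟨1, fun k => (hp1 k).le⟩ he
  have hLG : (L, (0 : F)) ∈ G :=
    hG.mem_of_tendsto (hL.prodMk_nhds (he.comp hφ.tendsto_atTop))
      (Eventually.of_forall fun k => hpG (φ k))
  have hL1 : ‖L‖ = 1 :=
    tendsto_nhds_unique hL.norm (by simp [hp1])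
  simp [hker L hLG] at hL1

/-- A closed linear relation `G` that is bounded below has a bounded solution operator for the
uniquely solvable weak problem `⟪e, e'⟫ = ⟪f, u'⟫` for all `(u', e') ∈ G`, with unknown
`(u, e) ∈ G`. -/
theorem exists_weak_solution [InnerProductSpace 𝕜 E] [InnerProductSpace 𝕜 F] [CompleteSpace E]
    [CompleteSpace F] {G : Submodule 𝕜 (E × F)} (hG : IsClosed (G : Set (E × F))) {C : ℝ}
    (hC : ∀ u e, (u, e) ∈ G → ‖u‖ ≤ C * ‖e‖) :
    ∃ (N : E →L[𝕜] E) (A : E → F), (∀ f, (N f, A f) ∈ G) ∧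
      (∀ f u e, (u, e) ∈ G → ⟪A f, e⟫_𝕜 = ⟪f, u⟫_𝕜) ∧
      ∀ f u e, (u, e) ∈ G → (∀ u' e', (u', e') ∈ G → ⟪e, e'⟫_𝕜 = ⟪f, u'⟫_𝕜) → N f = u := by
  suffices ∃ (N : E →L[𝕜] E) (A : E → F), (∀ f, (N f, A f) ∈ G) ∧
      ∀ f u e, (u, e) ∈ G → ⟪A f, e⟫_𝕜 = ⟪f, u⟫_𝕜 by
    obtain ⟨N, A, hNA, hweak⟩ := this
    refine ⟨N, A, hNA, hweak, fun f u e hue h => ?_⟩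
    have hsub := G.sub_mem (hNA f) hue
    have hzero : A f - e = 0 := by
      refine (inner_self_eq_zero (𝕜 := 𝕜)).1 ?_
      rw [inner_sub_left, hweak f _ _ hsub, h _ _ hsub, sub_self]
    have := hC _ _ hsub
    rw [hzero, norm_zero, mul_zero] at this
    exact sub_eq_zero.1 (norm_le_zero_iff.1 this)
  have : CompleteSpace G := hG.completeSpace_coe
  let p : G →L[𝕜] F := (ContinuousLinearMap.snd 𝕜 E F).comp G.subtypeL
  have hp : AntilipschitzWith (max C 1).toNNReal p := by
    refine ContinuousLinearMap.antilipschitz_of_bound p fun x => ?_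
    rw [Real.coe_toNNReal _ (le_max_of_le_right zero_le_one)]
    refine max_le ((hC _ _ x.2).trans ?_) ?_
    · exact mul_le_mul_of_nonneg_right (le_max_left _ _) (norm_nonneg _)
    · exact le_mul_of_one_le_left (norm_nonneg _) (le_max_right _ _)
  have hcl : IsClosed (Set.range p) := hp.isClosed_range p.uniformContinuous
  have : CompleteSpace p.range := hcl.completeSpace_coe
  let i : G ≃L[𝕜] p.range := p.equivRange hp.injective hcl
  let J : p.range →L[𝕜] E :=
    ((ContinuousLinearMap.fst 𝕜 E F).comp G.subtypeL).comp (i.symm : p.range →L[𝕜] G)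
  have hi (w : p.range) : ((i.symm w : G) : E × F).2 = w :=
    congrArg Subtype.val (i.apply_symm_apply w)
  refine ⟨J.comp J.adjoint, fun f => (J.adjoint f : p.range), fun f => ?_, fun f u e hue => ?_⟩
  · have := (i.symm (J.adjoint f)).2
    rwa [← Prod.mk.eta (p := ((i.symm (J.adjoint f) : G) : E × F)), hi] at this
  · have h := ContinuousLinearMap.adjoint_inner_left J (i ⟨(u, e), hue⟩) f
    have hJ : J (i ⟨(u, e), hue⟩) = u := by
      change ((i.symm (i ⟨(u, e), hue⟩) : G) : E × F).1 = u
      rw [i.symm_apply_apply]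
    rw [hJ] at h
    exact h

end Submodule

section

variable (T : H₀ →ₗ.[ℂ] H₁) (S : H₁ →ₗ.[ℂ] H₂)

/-- The graph of `u ↦ (S u, T* u)` restricted to the orthogonal complement of the harmonic space,
with the Hilbert sum `H₂ ⊕ H₀` as target. -/
noncomputable def reducedGraph : Submodule ℂ (H₁ × WithLp 2 (H₂ × H₀)) where
  carrier := {p | (p.1, p.2.fst) ∈ S.graph ∧ (p.1, p.2.snd) ∈ T.adjoint.graph ∧
    p.1 ∈ (harmonicSpace T S)ᗮ}
  zero_mem' := ⟨S.graph.zero_mem, T.adjoint.graph.zero_mem, Submodule.zero_mem _⟩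
  add_mem' h k := ⟨S.graph.add_mem h.1 k.1, T.adjoint.graph.add_mem h.2.1 k.2.1,
    Submodule.add_mem _ h.2.2 k.2.2⟩
  smul_mem' c _ h := ⟨S.graph.smul_mem c h.1, T.adjoint.graph.smul_mem c h.2.1,
    Submodule.smul_mem _ c h.2.2⟩

variable {T S}

theorem mem_harmonicSpace {u : H₁} :
    u ∈ harmonicSpace T S ↔ (u, 0) ∈ S.graph ∧ (u, 0) ∈ T.adjoint.graph := Iff.rfl

theorem mem_reducedGraph {u : H₁} {a : H₂} {b : H₀} :
    (u, WithLp.toLp 2 (a, b)) ∈ reducedGraph T S ↔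
      (u, a) ∈ S.graph ∧ (u, b) ∈ T.adjoint.graph ∧ u ∈ (harmonicSpace T S)ᗮ := Iff.rfl

theorem isClosed_reducedGraph (hT : Dense (T.domain : Set H₀)) (hS : S.IsClosed) :
    IsClosed (reducedGraph T S : Set (H₁ × WithLp 2 (H₂ × H₀))) := by
  have hofLp : Continuous fun p : H₁ × WithLp 2 (H₂ × H₀) => WithLp.ofLp p.2 :=
    (WithLp.prod_continuous_ofLp 2 H₂ H₀).comp continuous_snd
  refine IsClosed.inter (IsClosed.preimage (continuous_fst.prodMk hofLp.fst) hS) <|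
    IsClosed.inter (IsClosed.preimage (continuous_fst.prodMk hofLp.snd)
      (LinearPMap.adjoint_isClosed hT)) <|
    (Submodule.isClosed_orthogonal _).preimage continuous_fst

theorem CompactnessProperty.exists_bound (h : CompactnessProperty T S)
    (hT : Dense (T.domain : Set H₀)) (hS : S.IsClosed) :
    ∃ C : ℝ, ∀ u e, (u, e) ∈ reducedGraph T S → ‖u‖ ≤ C * ‖e‖ := by
  refine Submodule.exists_bound_of_precompact (isClosed_reducedGraph hT hS) ?_ ?_
  · rintro u ⟨hS, hT, hu⟩
    exact inner_self_eq_zero.1 (hu u ⟨hS, hT⟩)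
  · intro u e hue hM he
    have hofLp := ((WithLp.prod_continuous_ofLp 2 H₂ H₀).tendsto 0).comp he
    refine h u (fun k => (e k).fst) (fun k => (e k).snd) (fun k => (hue k).1)
      (fun k => (hue k).2.1) hM ?_ ?_
    · simpa using hofLp.fst_nhds.norm
    · simpa using hofLp.snd_nhds.norm

/-- A weak solution of the Laplace equation with right-hand side `g` is a strong solution. -/
theorem mem_lapGraph_of_weak (hTclosed : T.IsClosed) (hT : Dense (T.domain : Set H₀))
    (hSclosed : S.IsClosed) (hS : Dense (S.domain : Set H₁))
    (hRanKer : ∀ (x : H₀) (y : H₁), (x, y) ∈ T.graph → (y, (0 : H₂)) ∈ S.graph)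
    {u g : H₁} {a : H₂} {b : H₀} (ha : (u, a) ∈ S.graph) (hb : (u, b) ∈ T.adjoint.graph)
    (hweak : ∀ v s t, (v, s) ∈ S.graph → (v, t) ∈ T.adjoint.graph →
      ⟪a, s⟫_ℂ + ⟪b, t⟫_ℂ = ⟪g, v⟫_ℂ) :
    (u, g) ∈ lapGraph T S := by
  let K : Submodule ℂ H₁ := S.graph.comap (LinearMap.id.prod 0)
  have hKcl : IsClosed (K : Set H₁) :=
    IsClosed.preimage (continuous_id.prodMk continuous_const) hSclosed
  have : CompleteSpace K := hKcl.completeSpace_coe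
  have hK (v : H₁) : (K.starProjection v, (0 : H₂)) ∈ S.graph := K.starProjection_apply_mem v
  have hKperp (v : H₁) : (v - K.starProjection v, (0 : H₀)) ∈ T.adjoint.graph := by
    rw [LinearPMap.mem_graph_adjoint_iff hT]
    intro x y hxy
    rw [inner_zero_right]
    exact K.sub_starProjection_mem_orthogonal v y (hRanKer x y hxy)
  have hsymm (v : H₁) : ⟪K.starProjection g, v⟫_ℂ = ⟪g, K.starProjection v⟫_ℂ :=
    K.inner_starProjection_left_eq_right g v
  refine ⟨a, b, g - K.starProjection g, K.starProjection g, ha, ?_, hb, ?_,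
    (sub_add_cancel _ _).symm⟩
  · rw [LinearPMap.mem_graph_adjoint_iff hS]
    intro v s hvs
    have := hweak (v - K.starProjection v) s 0
      (by simpa using S.graph.sub_mem hvs (hK v)) (hKperp v)
    rw [inner_zero_right, add_zero, inner_sub_right, ← hsymm, ← inner_sub_left] at this
    rw [← inner_conj_symm, this, inner_conj_symm]
  · refine hTclosed.mem_graph_of_adjoint hT fun v t hvt => ?_
    have := hweak (K.starProjection v) 0 t (hK v)
      (by simpa using T.adjoint.graph.sub_mem hvt (hKperp v))
    rwa [inner_zero_right, zero_add, ← hsymm] at this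

end

/-- Existence of the Neumann operator `N`:  if `P : H₁ → H₁` is the orthogonal
projection onto the harmonic space `ℋ = Ker S ∩ Ker T*` (i.e. `P u ∈ ℋ` and `u - P u ⟂ ℋ`
for all `u`), then there is a bounded operator `N : H₁ → H₁` with `N(H₁) ⊆ Dom Δ` and
`Δ (N u) = u - P u` (encoded as `(N u, u - P u) ∈ lapGraph T S`), `N (Δ u) = u - P u`
for `u ∈ Dom Δ`, and `P ∘ N = N ∘ P = 0`. -/
theorem stmt6 (T : H₀ →ₗ.[ℂ] H₁) (S : H₁ →ₗ.[ℂ] H₂)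
    (hTclosed : T.IsClosed) (hTdense : Dense (T.domain : Set H₀))
    (hSclosed : S.IsClosed) (hSdense : Dense (S.domain : Set H₁))
    (hRanKer : ∀ (x : H₀) (y : H₁), (x, y) ∈ T.graph → (y, (0 : H₂)) ∈ S.graph)
    (hcpt : CompactnessProperty T S)
    (P : H₁ →L[ℂ] H₁)
    (hPmem : ∀ u : H₁, P u ∈ harmonicSpace T S)
    (hPorth : ∀ u : H₁, ∀ h ∈ harmonicSpace T S, @inner ℂ _ _ (u - P u) h = 0) :
    ∃ N : H₁ →L[ℂ] H₁,
      (∀ u : H₁, (N u, u - P u) ∈ lapGraph T S) ∧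
      (∀ u w : H₁, (u, w) ∈ lapGraph T S → N w = u - P u) ∧
      (∀ u : H₁, P (N u) = 0) ∧
      (∀ u : H₁, N (P u) = 0) := by
  have hPperp (u : H₁) : u - P u ∈ (harmonicSpace T S)ᗮ :=
    (Submodule.mem_orthogonal' _ _).2 (hPorth u)
  obtain ⟨C, hC⟩ := hcpt.exists_bound hTdense hSclosed
  have hcl := isClosed_reducedGraph hTdense hSclosed
  obtain ⟨N, A, hNA, hweak, hunique⟩ := Submodule.exists_weak_solution hcl hC
  refine ⟨N, fun f => ?_, ?_, fun f => ?_, fun f => ?_⟩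
  · refine mem_lapGraph_of_weak hTclosed hTdense hSclosed hSdense hRanKer (hNA f).1 (hNA f).2.1
      fun v s t hvs hvt => ?_
    have hPv := mem_harmonicSpace.1 (hPmem v)
    have hmem : (v - P v, WithLp.toLp 2 (s, t)) ∈ reducedGraph T S :=
      mem_reducedGraph.2 ⟨by simpa using S.graph.sub_mem hvs hPv.1,
        by simpa using T.adjoint.graph.sub_mem hvt hPv.2, hPperp v⟩
    have h := hweak f _ _ hmem
    rw [WithLp.prod_inner_apply] at h
    refine h.trans ?_
    have h₁ : ⟪P f, v - P v⟫_ℂ = 0 := hPperp v _ (hPmem f)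
    have h₂ : ⟪f - P f, P v⟫_ℂ = 0 := hPorth f _ (hPmem v)
    rw [← sub_zero (⟪f, v - P v⟫_ℂ), ← h₁, ← inner_sub_left, inner_sub_right, h₂, sub_zero]
  · rintro u w ⟨a, b, c, d, ha, hc, hb, hd, hw⟩
    have hPu := mem_harmonicSpace.1 (hPmem u)
    refine hunique w (u - P u) (WithLp.toLp 2 (a, b))
      (mem_reducedGraph.2 ⟨by simpa using S.graph.sub_mem ha hPu.1,
        by simpa using T.adjoint.graph.sub_mem hb hPu.2, hPperp u⟩) fun u' e' h => ?_
    have h₁ := (LinearPMap.mem_graph_adjoint_iff hSdense).1 hc _ _ h.1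
    have h₂ := (LinearPMap.mem_graph_adjoint_iff hTdense).1 h.2.1 _ _ hd
    rw [WithLp.prod_inner_apply]
    obtain rfl : w = c + d := hw
    rw [inner_add_left, h₂, ← inner_conj_symm c, ← h₁, inner_conj_symm]
    rfl
  · have h : P (N f) ∈ (harmonicSpace T S)ᗮ := by
      simpa using Submodule.sub_mem _ (hNA f).2.2 (hPperp (N f))
    exact inner_self_eq_zero.1 (h _ (hPmem (N f)))
  · refine hunique (P f) 0 0 (Submodule.zero_mem _) fun u' e' h => ?_
    rw [inner_zero_left]
    exact (h.2.2 _ (hPmem f)).symm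
end

section
/- Let V ⊆ ℂⁿ be open, let L ⊆ V be closed and pseudoconcave in V, and suppose L is contained in a hypersurface L' of V. Then L is itself a hypersurface of V. -/
open Metric Set

/-- A set `U ⊆ ℂⁿ` satisfies the Kontinuitätssatz:  for every family of closed holomorphic
discs in `U` (a continuous map `F` on `[0,1) × D̄`, holomorphic on `D` in the second variable,
with image in `U`) such that the union of the boundary circles is contained in a compact
subset of `U`, the union of the full closed discs is contained in a compact subset of `U`. -/
def SatisfiesKont {n : ℕ} (U : Set (Fin n → ℂ)) : Prop :=
  ∀ F : ℝ × ℂ → (Fin n → ℂ),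
    ContinuousOn F (Ico (0 : ℝ) 1 ×ˢ closedBall (0 : ℂ) 1) →
    (∀ t ∈ Ico (0 : ℝ) 1, DifferentiableOn ℂ (fun z => F (t, z)) (ball (0 : ℂ) 1)) →
    (∀ t ∈ Ico (0 : ℝ) 1, ∀ z ∈ closedBall (0 : ℂ) 1, F (t, z) ∈ U) →
    (∃ K : Set (Fin n → ℂ), K ⊆ U ∧ IsCompact K ∧
      ∀ t ∈ Ico (0 : ℝ) 1, ∀ z ∈ sphere (0 : ℂ) 1, F (t, z) ∈ K) →
    ∃ K : Set (Fin n → ℂ), K ⊆ U ∧ IsCompact K ∧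
      ∀ t ∈ Ico (0 : ℝ) 1, ∀ z ∈ closedBall (0 : ℂ) 1, F (t, z) ∈ K

/-- A closed subset `L` of an open set `V ⊆ ℂⁿ` is pseudoconcave in `V` if every point of `L`
has an open neighbourhood `W ⊆ V` such that `W ∖ L` satisfies the Kontinuitätssatz. -/
def PseudoconcaveIn {n : ℕ} (L V : Set (Fin n → ℂ)) : Prop :=
  ∀ x ∈ L, ∃ W : Set (Fin n → ℂ), IsOpen W ∧ W ⊆ V ∧ x ∈ W ∧ SatisfiesKont (W \ L)

/-- `A` is a hypersurface of the open set `V ⊆ ℂⁿ`:  `A` is a closed subset of `V` such that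
every `p ∈ A` has an open neighbourhood `U ⊆ V` and a holomorphic function `h : U → ℂ`, not
identically zero on any connected component of `U`, with `A ∩ U = h⁻¹(0)`. -/
def IsHypersurfaceIn {n : ℕ} (A V : Set (Fin n → ℂ)) : Prop :=
  A ⊆ V ∧ (∀ x ∈ V, x ∈ closure A → x ∈ A) ∧
  ∀ p ∈ A, ∃ U : Set (Fin n → ℂ), IsOpen U ∧ U ⊆ V ∧ p ∈ U ∧
    ∃ h : (Fin n → ℂ) → ℂ, DifferentiableOn ℂ h U ∧
      (∀ q ∈ U, ∃ z ∈ connectedComponentIn U q, h z ≠ 0) ∧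
      A ∩ U = {z ∈ U | h z = 0}

open Filter Topology MeasureTheory in
/-- Holomorphic dependence of a circle integral on the centre of the circle, in `ℂⁿ`. -/
theorem differentiableAt_circleIntegral_translate {n : ℕ} {U : Set (Fin n → ℂ)} (hU : IsOpen U)
    {g : (Fin n → ℂ) → ℂ} (hg : DifferentiableOn ℂ g U) {κ : ℂ → ℂ} {r : ℝ} (hr : 0 ≤ r)
    (hκ : ContinuousOn κ (sphere 0 r)) {u x₀ : Fin n → ℂ}
    (hx : ∀ t ∈ sphere (0 : ℂ) r, x₀ + t • u ∈ U) :
    DifferentiableAt ℂ (fun x => ∮ t in C(0, r), κ t * g (x + t • u)) x₀ := by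
  have hK : IsCompact ((fun t : ℂ => x₀ + t • u) '' sphere (0 : ℂ) r) :=
    (isCompact_sphere _ _).image (by fun_prop)
  obtain ⟨ε, hε, hεU⟩ := hK.exists_cthickening_subset_open hU
    (by rintro _ ⟨t, ht, rfl⟩; exact hx t ht)
  set K' := cthickening ε ((fun t : ℂ => x₀ + t • u) '' sphere (0 : ℂ) r)
  have hK' : IsCompact K' := hK.cthickening
  obtain ⟨M, hM⟩ := hK'.exists_bound_of_continuousOn (hg.continuousOn.mono hεU)
  obtain ⟨C, hC⟩ := (isCompact_sphere (0 : ℂ) r).exists_bound_of_continuousOn hκ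
  have hsub : ∀ y ∈ ball x₀ (ε / 2), ∀ t ∈ sphere (0 : ℂ) r,
      ball (y + t • u) (ε / 2) ⊆ K' := by
    intro y hy t ht z hz
    refine mem_cthickening_of_dist_le z (x₀ + t • u) ε _ ⟨t, ht, rfl⟩ ?_
    have h1 : dist (y + t • u) (x₀ + t • u) = dist y x₀ := by simp
    have := dist_triangle z (y + t • u) (x₀ + t • u)
    rw [h1] at this
    rw [mem_ball] at hy hz
    linarith
  have hmem : ∀ y ∈ ball x₀ (ε / 2), ∀ t ∈ sphere (0 : ℂ) r, y + t • u ∈ K' :=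
    fun y hy t ht => hsub y hy t ht (mem_ball_self (by positivity))
  have hfd : ∀ y ∈ ball x₀ (ε / 2), ∀ t ∈ sphere (0 : ℂ) r,
      ‖fderiv ℂ g (y + t • u)‖ ≤ (2 * M) / (ε / 2) := by
    intro y hy t ht
    refine Complex.norm_fderiv_le_div_of_mapsTo_ball
      (hg.mono ((hsub y hy t ht).trans hεU)) ?_ (by positivity)
    intro z hz
    rw [mem_closedBall, dist_eq_norm]
    have h1 := hM z (hsub y hy t ht hz)
    have h2 := hM _ (hmem y hy t ht)
    calc _ ≤ ‖g z‖ + ‖g (y + t • u)‖ := norm_sub_le _ _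
      _ ≤ _ := by linarith
  have hc : ∀ θ, circleMap 0 r θ ∈ sphere (0 : ℂ) r := fun θ => circleMap_mem_sphere 0 hr θ
  have hcont : ∀ y ∈ ball x₀ (ε / 2), Continuous
      (fun θ : ℝ => deriv (circleMap 0 r) θ • (κ (circleMap 0 r θ) *
        g (y + circleMap 0 r θ • u))) := by
    intro y hy
    have h1 : Continuous (fun θ : ℝ => κ (circleMap 0 r θ)) :=
      hκ.comp_continuous (continuous_circleMap 0 r) hc
    have h2 : Continuous (fun θ : ℝ => g (y + circleMap 0 r θ • u)) :=
      (hg.continuousOn.mono hεU).comp_continuous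
        (continuous_const.add ((continuous_circleMap 0 r).smul continuous_const))
        (fun θ => hmem y hy _ (hc θ))
    have h3 : Continuous (fun θ : ℝ => deriv (circleMap 0 r) θ) := by
      simp only [deriv_circleMap]
      exact (continuous_circleMap 0 r).mul continuous_const
    exact h3.smul (h1.mul h2)
  have hball : ball x₀ (ε / 2) ∈ 𝓝 x₀ := ball_mem_nhds _ (by positivity)
  have key := intervalIntegral.hasFDerivAt_integral_of_dominated_of_fderiv_le
    (μ := volume) (a := 0) (b := 2 * Real.pi) (𝕜 := ℂ)
    (F := fun x θ => deriv (circleMap 0 r) θ • (κ (circleMap 0 r θ) *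
        g (x + circleMap 0 r θ • u)))
    (F' := fun x θ => (deriv (circleMap 0 r) θ * κ (circleMap 0 r θ)) •
      fderiv ℂ g (x + circleMap 0 r θ • u))
    (bound := fun _ => |r| * C * ((2 * M) / (ε / 2)))
    (x₀ := x₀) hball
    (by filter_upwards [hball] with y hy using (hcont y hy).aestronglyMeasurable)
    ((hcont x₀ (mem_ball_self (by positivity))).intervalIntegrable _ _)
    (by
      have h1 : Measurable (fun θ : ℝ => fderiv ℂ g (x₀ + circleMap 0 r θ • u)) :=
        (measurable_fderiv ℂ g).comp (by
          exact (continuous_const.add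
            ((continuous_circleMap 0 r).smul continuous_const)).measurable)
      have h2 : Continuous (fun θ : ℝ => deriv (circleMap 0 r) θ * κ (circleMap 0 r θ)) := by
        simp only [deriv_circleMap]
        exact ((continuous_circleMap 0 r).mul continuous_const).mul
          (hκ.comp_continuous (continuous_circleMap 0 r) hc)
      exact (h2.measurable.smul h1).aestronglyMeasurable)
    (by
      refine Eventually.of_forall fun θ _ y hy => ?_
      rw [norm_smul, norm_mul]
      have h1 : ‖deriv (circleMap 0 r) θ‖ = |r| := by simp
      rw [h1]
      have h2 := hC _ (hc θ)
      have h3 := hfd y hy _ (hc θ)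
      have : 0 ≤ C := (norm_nonneg _).trans h2
      gcongr)
    (by simp)
    (by
      refine Eventually.of_forall fun θ _ y hy => ?_
      have h1 : HasFDerivAt g (fderiv ℂ g (y + circleMap 0 r θ • u)) (y + circleMap 0 r θ • u) :=
        (hg.differentiableAt (hU.mem_nhds (hεU (hmem y hy _ (hc θ))))).hasFDerivAt
      have h2 : HasFDerivAt (fun x => g (x + circleMap 0 r θ • u))
          (fderiv ℂ g (y + circleMap 0 r θ • u)) y := by
        have h := h1.comp y ((hasFDerivAt_id y).add_const (circleMap 0 r θ • u))
        rwa [ContinuousLinearMap.comp_id] at h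
      have h3 := (h2.const_mul (κ (circleMap 0 r θ))).const_smul (deriv (circleMap 0 r) θ)
      rw [mul_smul]
      exact h3)
  exact key.differentiableAt

open Filter Topology in
/-- Riemann's theorem on removable singularities for finitely many points of a disc. -/
theorem exists_continuousOn_closedBall_of_bounded_off_finite {f : ℂ → ℂ} {r : ℝ} {Z : Set ℂ}
    (hZ : Z.Finite) (hZr : Z ⊆ ball 0 r) (hfc : ContinuousOn f (closedBall 0 r \ Z))
    (hfd : ∀ z ∈ ball 0 r \ Z, DifferentiableAt ℂ f z)
    (hfb : ∀ a ∈ Z, (𝓝[≠] a).IsBoundedUnder (· ≤ ·) fun z => ‖f z‖) :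
    ∃ g : ℂ → ℂ, ContinuousOn g (closedBall 0 r) ∧ (∀ z ∈ ball 0 r \ Z, DifferentiableAt ℂ g z) ∧
      ∀ z ∉ Z, g z = f z := by
  classical
  refine ⟨fun z => if z ∈ Z then limUnder (𝓝[≠] z) f else f z, ?_, ?_, fun z hz => if_neg hz⟩
  · intro z hz
    by_cases hzZ : z ∈ Z
    · have hnear : ∀ᶠ w in 𝓝[≠] z, w ∈ ball 0 r \ Z := by
        have h1 : ball 0 r \ (Z \ {z}) ∈ 𝓝 z :=
          (isOpen_ball.sdiff (hZ.subset sdiff_subset).isClosed).mem_nhds ⟨hZr hzZ, by simp⟩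
        filter_upwards [nhdsWithin_le_nhds h1, self_mem_nhdsWithin] with w hw hwz
        exact ⟨hw.1, fun h => hw.2 ⟨h, hwz⟩⟩
      obtain ⟨b, hb⟩ := hfb z hzZ
      have ht := Complex.tendsto_limUnder_of_differentiable_on_punctured_nhds_of_bounded_under
        (f := f) (c := z) (hnear.mono fun w hw => hfd w hw) (by
          refine ⟨b + ‖f z‖, ?_⟩
          rw [eventually_map] at hb ⊢
          filter_upwards [hb] with w hw
          exact (norm_sub_le _ _).trans (by gcongr))
      refine ContinuousAt.continuousWithinAt ?_
      rw [continuousAt_iff_punctured_nhds]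
      simp only [hzZ, if_true]
      refine ht.congr' ?_
      filter_upwards [hnear] with w hw
      simp [hw.2]
    · have h1 : Zᶜ ∈ 𝓝 z := hZ.isClosed.isOpen_compl.mem_nhds hzZ
      have h2 : ContinuousWithinAt f (closedBall 0 r) z := by
        have := hfc z ⟨hz, hzZ⟩
        rw [sdiff_eq, inter_comm] at this
        exact (continuousWithinAt_inter' (mem_nhdsWithin_of_mem_nhds h1)).1
          (by rwa [inter_comm])
      refine h2.congr_of_eventuallyEq ?_ (by simp [hzZ])
      filter_upwards [mem_nhdsWithin_of_mem_nhds h1] with w hw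
      exact if_neg hw
  · intro z hz
    have h1 : Zᶜ ∈ 𝓝 z := hZ.isClosed.isOpen_compl.mem_nhds hz.2
    refine (hfd z hz).congr_of_eventuallyEq ?_
    filter_upwards [h1] with w hw
    exact if_neg hw

open Filter Topology in
theorem finite_zeros_closedBall {f : ℂ → ℂ} {r : ℝ}
    (hf : AnalyticOnNhd ℂ f (closedBall 0 r)) {w : ℂ} (hw : w ∈ closedBall 0 r) (hfw : f w ≠ 0) :
    {z ∈ closedBall (0 : ℂ) r | f z = 0}.Finite := by
  by_contra hinf
  obtain ⟨a, ha, hacc⟩ := Set.Infinite.exists_accPt_of_subset_isCompact hinf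
    (isCompact_closedBall (0 : ℂ) r) (fun z hz => hz.1)
  have := hf.eqOn_zero_of_preconnected_of_frequently_eq_zero
    (convex_closedBall _ _).isPreconnected ha
    ((accPt_iff_frequently_nhdsNE.1 hacc).mono fun z hz => hz.2)
  exact hfw (this hw)

open Filter Topology in
/-- The argument principle for moments of the zeros in a disc. -/
theorem circleIntegral_pow_mul_logDeriv {f : ℂ → ℂ} {r : ℝ} (hr : 0 < r)
    (hf : AnalyticOnNhd ℂ f (closedBall 0 r)) (hfs : ∀ z ∈ sphere (0 : ℂ) r, f z ≠ 0)
    (Z : Finset ℂ) (hZ : ∀ z, z ∈ Z ↔ z ∈ ball (0 : ℂ) r ∧ f z = 0) :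
    ∃ μ : ℂ → ℕ, (∀ a ∈ Z, μ a ≠ 0) ∧ ∀ j : ℕ,
      (∮ z in C(0, r), z ^ j * (deriv f z / f z)) =
        (2 * Real.pi * Complex.I) * ∑ a ∈ Z, (μ a : ℂ) * a ^ j := by
  classical
  have hZr : ∀ a ∈ Z, a ∈ ball (0 : ℂ) r := fun a ha => ((hZ a).1 ha).1
  have hloc : ∀ a : ℂ, ∃ m : ℕ, a ∈ Z → m ≠ 0 ∧ ∃ g : ℂ → ℂ, AnalyticAt ℂ g a ∧ g a ≠ 0 ∧
      ∀ᶠ z in 𝓝 a, f z = (z - a) ^ m * g z := by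
    intro a
    by_cases ha : a ∈ Z
    · obtain ⟨hab, ha0⟩ := (hZ a).1 ha
      have hne : ¬ ∀ᶠ z in 𝓝 a, f z = 0 := by
        intro h
        have := hf.eqOn_zero_of_preconnected_of_eventuallyEq_zero
          (convex_closedBall _ _).isPreconnected (ball_subset_closedBall hab) h
        have hrs : (r : ℂ) ∈ sphere (0 : ℂ) r := by simp [abs_of_pos hr]
        exact hfs _ hrs (this (sphere_subset_closedBall hrs))
      obtain ⟨m, g, hg, hga, hfg⟩ :=
        (hf a (ball_subset_closedBall hab)).exists_eventuallyEq_pow_smul_nonzero_iff.2 hne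
      refine ⟨m, fun _ => ⟨?_, g, hg, hga, hfg⟩⟩
      rintro rfl
      have := hfg.self_of_nhds
      simp [ha0, hga.symm] at this
    · exact ⟨0, fun h => absurd h ha⟩
  choose μ hμ using hloc
  refine ⟨μ, fun a ha => (hμ a ha).1, ?_⟩
  let G : ℂ → ℂ := fun z => deriv f z / f z - ∑ a ∈ Z, (μ a : ℂ) / (z - a)
  have hne : ∀ z ∈ closedBall (0 : ℂ) r \ (Z : Set ℂ), f z ≠ 0 := by
    intro z hz h0
    rcases (mem_closedBall.1 hz.1).lt_or_eq with h | h
    · exact hz.2 ((hZ z).2 ⟨h, h0⟩)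
    · exact hfs z h h0
  have hGd : ∀ z ∈ closedBall (0 : ℂ) r \ (Z : Set ℂ), DifferentiableAt ℂ G z := by
    intro z hz
    have h1 := (hf z hz.1).deriv.differentiableAt
    have h2 := (hf z hz.1).differentiableAt
    refine (h1.div h2 (hne z hz)).sub (DifferentiableAt.fun_sum fun a ha => ?_)
    refine (differentiableAt_const _).div (by fun_prop) ?_
    rw [sub_ne_zero]
    rintro rfl
    exact hz.2 ha
  have hGb : ∀ a ∈ (Z : Set ℂ), (𝓝[≠] a).IsBoundedUnder (· ≤ ·) fun z => ‖G z‖ := by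
    intro a ha
    obtain ⟨-, g, hg, hga, hfg⟩ := hμ a ha
    have hgne : ∀ᶠ z in 𝓝 a, g z ≠ 0 := hg.continuousAt.eventually_ne hga
    have hgan : ∀ᶠ z in 𝓝 a, AnalyticAt ℂ g z := hg.eventually_analyticAt
    have hEq : ∀ᶠ z in 𝓝[≠] a, G z = deriv g z / g z -
        ∑ b ∈ Z.erase a, (μ b : ℂ) / (z - b) := by
      filter_upwards [nhdsWithin_le_nhds hgne, nhdsWithin_le_nhds hgan,
        nhdsWithin_le_nhds hfg.eventually_nhds, self_mem_nhdsWithin] with z h1 h2 h3 h4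
      have hza : z - a ≠ 0 := sub_ne_zero.2 h4
      have hd : HasDerivAt (fun z => (z - a) ^ (μ a) * g z)
          ((μ a : ℂ) * (z - a) ^ (μ a - 1) * 1 * g z + (z - a) ^ (μ a) * deriv g z) z :=
        (((hasDerivAt_id z).sub_const a).pow (μ a)).mul h2.differentiableAt.hasDerivAt
      have hd' : deriv f z = _ := (Filter.EventuallyEq.deriv_eq h3).trans hd.deriv
      have hf' : f z = _ := h3.self_of_nhds
      have hp : (z - a) ^ (μ a) = (z - a) ^ (μ a - 1) * (z - a) :=
        (pow_sub_one_mul (hμ a ha).1 _).symm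
      simp only [G]
      rw [← Finset.add_sum_erase _ _ ha, hd', hf', hp]
      have : (z - a) ^ (μ a - 1) ≠ 0 := pow_ne_zero _ hza
      field_simp
      ring
    have hcont : ContinuousAt (fun z => deriv g z / g z -
        ∑ b ∈ Z.erase a, (μ b : ℂ) / (z - b)) a := by
      refine (hg.deriv.continuousAt.div hg.continuousAt hga).sub
        (tendsto_finsetSum _ fun b hb => ?_)
      refine ContinuousAt.div continuousAt_const (by fun_prop) ?_
      exact sub_ne_zero.2 (Finset.ne_of_mem_erase hb).symm
    have := (hcont.norm.tendsto.mono_left (nhdsWithin_le_nhds (s := {a}ᶜ))).isBoundedUnder_le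
    refine this.mono_le ?_
    filter_upwards [hEq] with z hz
    rw [hz]
  obtain ⟨g, hgc, hgd, hgG⟩ := exists_continuousOn_closedBall_of_bounded_off_finite (f := G)
    (r := r) (Z := (Z : Set ℂ)) Z.finite_toSet (fun a ha => hZr a ha)
    (fun z hz => (hGd z hz).continuousAt.continuousWithinAt)
    (fun z hz => hGd z ⟨ball_subset_closedBall hz.1, hz.2⟩) hGb
  intro j
  have hsZ : ∀ z ∈ sphere (0 : ℂ) r, z ∉ Z := by
    intro z hz h
    have := mem_ball.1 (hZr z h)
    rw [mem_sphere] at hz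
    linarith
  have hEq : EqOn (fun z => z ^ j * (deriv f z / f z))
      (fun z => z ^ j * g z + ∑ a ∈ Z, (μ a : ℂ) * ((z - a)⁻¹ • z ^ j)) (sphere 0 r) := by
    intro z hz
    have h1 := hgG z (by simpa using hsZ z hz)
    simp only [G] at h1
    simp only [h1, smul_eq_mul]
    rw [mul_sub, Finset.mul_sum, sub_add_eq_add_sub, eq_sub_iff_add_eq]
    congr 1
    refine Finset.sum_congr rfl fun a _ => ?_
    ring
  have hI1 : CircleIntegrable (fun z => z ^ j * g z) 0 r :=
    ContinuousOn.circleIntegrable hr.le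
      ((continuousOn_id.pow j).mul (hgc.mono sphere_subset_closedBall))
  have hI2 : ∀ a ∈ Z, CircleIntegrable (fun z => (μ a : ℂ) * ((z - a)⁻¹ • z ^ j)) 0 r := by
    intro a ha
    refine ContinuousOn.circleIntegrable hr.le (continuousOn_const.mul
      (ContinuousOn.smul (ContinuousOn.inv₀ (f := fun z => z - a) (by fun_prop) ?_)
        (g := fun z => z ^ j) (by fun_prop)))
    intro z hz
    rw [sub_ne_zero]
    rintro rfl
    exact hsZ _ hz ha
  rw [circleIntegral.integral_congr hr.le hEq, circleIntegral.integral_add hI1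
    (CircleIntegrable.fun_sum _ hI2), circleIntegral.integral_fun_sum hI2]
  have h0 : (∮ z in C(0, r), z ^ j * g z) = 0 :=
    Complex.circleIntegral_eq_zero_of_differentiable_on_off_countable hr.le
      Z.countable_toSet ((continuousOn_id.pow j).mul hgc)
      (fun z hz => (differentiableAt_id.pow j).mul (hgd z hz))
  rw [h0, zero_add, Finset.mul_sum]
  refine Finset.sum_congr rfl fun a ha => ?_
  rw [circleIntegral.integral_const_mul,
    Complex.circleIntegral_sub_inv_smul_of_differentiable_on_off_countable countable_empty
      (hZr a ha) (by fun_prop) (fun z _ => by fun_prop)]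
  simp only [smul_eq_mul]
  ring

open Filter Topology in
/-- The limit disc of a family of discs in a domain with the Kontinuitätssatz stays in the domain
as soon as its boundary does. -/
theorem SatisfiesKont.limit_disc_mem {n : ℕ} {U : Set (Fin n → ℂ)} (hU : SatisfiesKont U)
    {G : ℝ × ℂ → (Fin n → ℂ)} (hGc : ContinuousOn G (Icc (0 : ℝ) 1 ×ˢ closedBall (0 : ℂ) 1))
    (hGd : ∀ t ∈ Ico (0 : ℝ) 1, DifferentiableOn ℂ (fun z => G (t, z)) (ball (0 : ℂ) 1))
    (hGU : ∀ t ∈ Ico (0 : ℝ) 1, ∀ z ∈ closedBall (0 : ℂ) 1, G (t, z) ∈ U)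
    (hGb : ∀ z ∈ sphere (0 : ℂ) 1, G (1, z) ∈ U) : G (1, 0) ∈ U := by
  obtain ⟨K, hKU, hK, hGK⟩ := hU G (hGc.mono (prod_mono Ico_subset_Icc_self le_rfl)) hGd hGU
    ⟨G '' (Icc (0 : ℝ) 1 ×ˢ sphere (0 : ℂ) 1), by
      rintro _ ⟨⟨t, z⟩, ⟨ht, hz⟩, rfl⟩
      rcases eq_or_lt_of_le ht.2 with h | h
      · obtain rfl : t = 1 := h
        exact hGb z hz
      · exact hGU t ⟨ht.1, h⟩ z (sphere_subset_closedBall hz),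
      (isCompact_Icc.prod (isCompact_sphere _ _)).image_of_continuousOn
        (hGc.mono (prod_mono le_rfl sphere_subset_closedBall)),
      fun t ht z hz => ⟨(t, z), ⟨Ico_subset_Icc_self ht, hz⟩, rfl⟩⟩
  have h0 : (0 : ℂ) ∈ closedBall (0 : ℂ) 1 := by simp
  have hc : ContinuousOn (fun t : ℝ => G (t, 0)) (Icc 0 1) :=
    hGc.comp (by fun_prop) (fun t ht => ⟨ht, h0⟩)
  have h1 : (1 : ℝ) ∈ closure (Ico (0 : ℝ) 1) := by
    rw [closure_Ico (by norm_num)]; simp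
  refine hKU (hK.isClosed.closure_subset_iff.2 ?_
    (((hc 1 (by simp)).mono Ico_subset_Icc_self).mem_closure_image h1))
  rintro _ ⟨t, ht, rfl⟩
  exact hGK t ht 0 h0

open Filter Topology in
/-- A pseudoconcave set has no isolated point in an affine plane. -/
theorem SatisfiesKont.not_isolated {n : ℕ} {W L : Set (Fin n → ℂ)} (hW : IsOpen W)
    (hK : SatisfiesKont (W \ L)) {x u v : Fin n → ℂ} (hxW : x ∈ W) (hxL : x ∈ L) :
    ∃ᶠ c in 𝓝[≠] (0 : ℂ × ℂ), x + c.1 • u + c.2 • v ∈ L := by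
  intro hiso
  have hcont : Continuous (fun c : ℂ × ℂ => x + c.1 • u + c.2 • v) := by fun_prop
  have hWn : ∀ᶠ c in 𝓝 (0 : ℂ × ℂ), x + c.1 • u + c.2 • v ∈ W :=
    hcont.continuousAt.preimage_mem_nhds (hW.mem_nhds (by simpa using hxW))
  rw [eventually_nhdsWithin_iff] at hiso
  obtain ⟨ε, hε, hball⟩ := Metric.eventually_nhds_iff.1 (hiso.and hWn)
  set ρ : ℝ := ε / 2
  have hρ : 0 < ρ := by positivity
  have hdist : ∀ a b : ℂ, ‖a‖ ≤ ρ → ‖b‖ ≤ ρ → dist (a, b) (0 : ℂ × ℂ) < ε := by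
    intro a b ha hb
    rw [dist_zero_right, Prod.norm_mk]
    exact (max_le ha hb).trans_lt (half_lt_self hε)
  have hnorm1 : ∀ z : ℂ, ‖z‖ ≤ 1 → ‖(ρ : ℂ) * z‖ ≤ ρ := by
    intro z hz
    rw [norm_mul, Complex.norm_real, Real.norm_of_nonneg hρ.le]
    nlinarith
  have hnorm2 : ∀ t ∈ Icc (0 : ℝ) 1, ‖((1 - t : ℝ) : ℂ) * ρ‖ ≤ ρ := by
    intro t ht
    rw [norm_mul, Complex.norm_real, Complex.norm_real, Real.norm_of_nonneg hρ.le,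
      Real.norm_of_nonneg (by linarith [ht.2])]
    nlinarith [ht.1]
  have hmem : ∀ t ∈ Icc (0 : ℝ) 1, ∀ z ∈ closedBall (0 : ℂ) 1, (t ≠ 1 ∨ z ≠ 0) →
      x + ((ρ : ℂ) * z) • u + (((1 - t : ℝ) : ℂ) * ρ) • v ∈ W \ L := by
    intro t ht z hz hne
    have hd := hdist _ _ (hnorm1 z (by simpa using hz)) (hnorm2 t ht)
    have := hball hd
    refine ⟨this.2, this.1 ?_⟩
    simp only [mem_compl_iff, mem_singleton_iff, Prod.mk_eq_zero, mul_eq_zero,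
      Complex.ofReal_eq_zero, hρ.ne', false_or, or_false, not_and_or]
    rcases hne with h | h
    · exact Or.inr fun h' => h (by linarith)
    · exact Or.inl h
  have := hK.limit_disc_mem
    (G := fun c => x + ((ρ : ℂ) * c.2) • u + (((1 - c.1 : ℝ) : ℂ) * ρ) • v)
    (by fun_prop) (fun t _ => by dsimp only; fun_prop)
    (fun t ht z hz => hmem t (Ico_subset_Icc_self ht) z hz (Or.inl ht.2.ne))
    (fun z hz => hmem 1 (by simp) z (sphere_subset_closedBall hz)
      (Or.inr (by rintro rfl; simp at hz)))
  exact this.2 (by simpa using hxL)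

open Filter Topology in
/-- A pseudoconcave set contained, near one of its points, in a holomorphic graph coincides with
this graph near the point. -/
theorem SatisfiesKont.eventually_graph_mem {n : ℕ} {W L : Set (Fin n → ℂ)} (hW : IsOpen W)
    (hL : ∀ x ∈ W, x ∈ closure L → x ∈ L)
    (hK : SatisfiesKont (W \ L)) {x₁ v : Fin n → ℂ} {α : (Fin n → ℂ) → ℂ}
    (hα : ∀ᶠ x in 𝓝 x₁, DifferentiableAt ℂ α x) (hxW : x₁ + α x₁ • v ∈ W)
    (hxL : x₁ + α x₁ • v ∈ L) {ε : ℝ} (hε : 0 < ε)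
    (hgraph : ∀ᶠ x in 𝓝 x₁, ∀ w ∈ ball (α x₁) ε, x + w • v ∈ L → w = α x) :
    ∀ᶠ x in 𝓝 x₁, x + α x • v ∈ L := by
  have hWn : ∀ᶠ c in 𝓝 (x₁, α x₁), c.1 + c.2 • v ∈ W := by
    have : Continuous (fun c : (Fin n → ℂ) × ℂ => c.1 + c.2 • v) := by fun_prop
    exact this.continuousAt.preimage_mem_nhds (hW.mem_nhds hxW)
  obtain ⟨ε₀, hε₀, hW₀⟩ := Metric.eventually_nhds_iff.1 hWn
  set ε' := min ε ε₀ with hε'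
  have hε'0 : 0 < ε' := lt_min hε hε₀
  have hαc : ∀ᶠ x in 𝓝 x₁, dist (α x) (α x₁) < ε' / 2 :=
    (hα.self_of_nhds.continuousAt).eventually (ball_mem_nhds _ (by positivity))
  have hx₀ : ∀ᶠ x in 𝓝 x₁, dist x x₁ < ε₀ := ball_mem_nhds _ hε₀
  obtain ⟨R, hR, hB⟩ := Metric.eventually_nhds_iff_ball.1 (hα.and (hgraph.and (hαc.and hx₀)))
  filter_upwards [ball_mem_nhds x₁ hR] with x₂ hx₂
  by_contra hx₂L
  let l : ℂ → (Fin n → ℂ) := fun ζ => x₂ + ζ • (x₁ - x₂)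
  have hl : Continuous l := by fun_prop
  have hlR : ∀ τ ∈ Icc (0 : ℝ) 1, l τ ∈ ball x₁ R := by
    intro τ hτ
    rw [mem_ball, dist_eq_norm] at hx₂ ⊢
    have : l τ - x₁ = ((1 - τ : ℝ) : ℂ) • (x₂ - x₁) := by
      simp only [l]; push_cast; module
    rw [this, norm_smul, Complex.norm_real, Real.norm_of_nonneg (by linarith [hτ.2])]
    have := norm_nonneg (x₂ - x₁)
    nlinarith [hτ.1, hτ.2]
  let Φ : (Fin n → ℂ) → (Fin n → ℂ) := fun x => x + α x • v
  have hΦ : ∀ x ∈ ball x₁ R, ContinuousAt Φ x := fun x hx =>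
    continuousAt_id.add ((hB x hx).1.continuousAt.smul continuousAt_const)
  have hmemW : ∀ x ∈ ball x₁ R, ∀ w ∈ ball (α x₁) ε', x + w • v ∈ W := by
    intro x hx w hw
    refine @hW₀ (x, w) ?_
    rw [Prod.dist_eq]
    exact max_lt (hB x hx).2.2.2 (lt_of_lt_of_le (mem_ball.1 hw) (min_le_right _ _))
  have hαmem : ∀ x ∈ ball x₁ R, α x ∈ ball (α x₁) ε' := fun x hx =>
    mem_ball.2 ((hB x hx).2.2.1.trans (half_lt_self hε'0))
  let S : Set ℝ := {τ | τ ∈ Icc (0 : ℝ) 1 ∧ Φ (l τ) ∈ L}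
  have hSclosed : IsClosed S := by
    refine isClosed_of_closure_subset fun τ hτ => ?_
    have hτ1 : τ ∈ Icc (0 : ℝ) 1 :=
      isClosed_Icc.closure_subset_iff.2 (fun s (hs : s ∈ S) => hs.1) hτ
    refine ⟨hτ1, hL _ (hmemW _ (hlR τ hτ1) _ (hαmem _ (hlR τ hτ1))) ?_⟩
    have hc : ContinuousAt (fun τ : ℝ => Φ (l τ)) τ :=
      ContinuousAt.comp (f := fun τ : ℝ => l τ) (hΦ _ (hlR τ hτ1))
        (hl.comp Complex.continuous_ofReal).continuousAt
    refine closure_mono ?_ (hc.continuousWithinAt.mem_closure_image hτ)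
    rintro _ ⟨s, hs, rfl⟩
    exact hs.2
  have h1S : (1 : ℝ) ∈ S := ⟨by simp, by simpa [Φ, l] using hxL⟩
  have hbdd : BddBelow S := ⟨0, fun s hs => hs.1.1⟩
  set τ := sInf S with hτdef
  have hτS : τ ∈ S := hSclosed.csInf_mem ⟨1, h1S⟩ hbdd
  have hτ0 : 0 < τ := by
    refine lt_of_le_of_ne hτS.1.1 fun h => hx₂L ?_
    have := hτS.2
    rw [← h] at this
    simpa [Φ, l] using this
  have hlt : ∀ s, 0 ≤ s → s < τ → Φ (l s) ∉ L := fun s hs0 hsτ h =>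
    (notMem_of_lt_csInf hsτ hbdd) ⟨⟨hs0, hsτ.le.trans hτS.1.2⟩, h⟩
  have hnear : ∀ᶠ ζ in 𝓝 (0 : ℂ), l (τ + ζ) ∈ ball x₁ R := by
    have : Continuous (fun ζ : ℂ => l (τ + ζ)) := by fun_prop
    exact this.continuousAt.preimage_mem_nhds
      (isOpen_ball.mem_nhds (by simpa using hlR τ hτS.1))
  obtain ⟨ρ₀, hρ₀, hρB⟩ := Metric.eventually_nhds_iff.1 hnear
  set ρ := min (ρ₀ / 2) 1
  have hρ : 0 < ρ := lt_min (by positivity) one_pos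
  have hρ1 : ρ ≤ 1 := min_le_right _ _
  have hX : ∀ z : ℂ, ‖z‖ ≤ 1 → l (τ + ρ * z) ∈ ball x₁ R := by
    intro z hz
    refine hρB ?_
    rw [dist_zero_right, norm_mul, Complex.norm_real, Real.norm_of_nonneg hρ.le]
    have : ρ ≤ ρ₀ / 2 := min_le_left _ _
    nlinarith [norm_nonneg z]
  set η := min ρ τ / 2
  have hη : 0 < η := half_pos (lt_min hρ hτ0)
  have hηρ : η < ρ := by
    have : min ρ τ ≤ ρ := min_le_left _ _
    simp only [η]; linarith
  have hητ : η < τ := by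
    have : min ρ τ ≤ τ := min_le_right _ _
    simp only [η]; linarith
  set κ := ε' / 8
  have hκ : 0 < κ := by positivity
  let s : ℝ → ℂ → ℂ := fun t z => (κ : ℂ) * (ρ * z + ((1 - t : ℝ) : ℂ) * η)
  have hs : ∀ t ∈ Icc (0 : ℝ) 1, ∀ z : ℂ, ‖z‖ ≤ 1 → ‖s t z‖ < ε' / 2 := by
    intro t ht z hz
    have h1 : ‖(ρ : ℂ) * z + ((1 - t : ℝ) : ℂ) * η‖ ≤ 2 := by
      refine (norm_add_le _ _).trans ?_
      rw [norm_mul, norm_mul, Complex.norm_real, Complex.norm_real, Complex.norm_real,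
        Real.norm_of_nonneg hρ.le, Real.norm_of_nonneg hη.le,
        Real.norm_of_nonneg (by linarith [ht.2])]
      nlinarith [norm_nonneg z, ht.1, ht.2]
    simp only [s]
    rw [norm_mul, Complex.norm_real, Real.norm_of_nonneg hκ.le]
    simp only [κ] at *
    nlinarith
  have hmem : ∀ t ∈ Icc (0 : ℝ) 1, ∀ z : ℂ, ‖z‖ ≤ 1 → (t ≠ 1 ∨ z ≠ 0) →
      l (τ + ρ * z) + (α (l (τ + ρ * z)) + s t z) • v ∈ W \ L := by
    intro t ht z hz hne
    have hXz := hX z hz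
    have hw : α (l (τ + ρ * z)) + s t z ∈ ball (α x₁) ε' := by
      rw [mem_ball, dist_eq_norm]
      have h1 := (hB _ hXz).2.2.1
      rw [dist_eq_norm] at h1
      calc _ = ‖(α (l (τ + ρ * z)) - α x₁) + s t z‖ := by ring_nf
        _ ≤ _ := norm_add_le _ _
        _ < ε' / 2 + ε' / 2 := add_lt_add h1 (hs t ht z hz)
        _ = ε' := by ring
    refine ⟨hmemW _ hXz _ hw, fun hmemL => ?_⟩
    have h1 := (hB _ hXz).2.1 _ (ball_subset_ball (min_le_left _ _) hw) hmemL
    have h2 : s t z = 0 := by simpa using h1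
    have h3 : (ρ : ℂ) * z = -(((1 - t : ℝ) : ℂ) * η) := by
      have : (κ : ℂ) ≠ 0 := by exact_mod_cast hκ.ne'
      exact eq_neg_of_add_eq_zero_left ((mul_eq_zero.1 h2).resolve_left this)
    by_cases ht1 : t = 1
    · subst ht1
      rcases hne with h | h
      · exact h rfl
      · apply h
        have : (ρ : ℂ) ≠ 0 := by exact_mod_cast hρ.ne'
        simpa [this] using h3
    · have ht2 : t < 1 := lt_of_le_of_ne ht.2 ht1
      have h4 : (τ : ℂ) + ρ * z = ((τ - (1 - t) * η : ℝ) : ℂ) := by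
        rw [h3]; push_cast; ring
      rw [h2, add_zero, h4] at hmemL
      exact hlt _ (by nlinarith [ht.1]) (by nlinarith) hmemL
  have hXc : ContinuousOn (fun c : ℝ × ℂ => l (τ + ρ * c.2))
      (Icc (0 : ℝ) 1 ×ˢ closedBall (0 : ℂ) 1) := by fun_prop
  have hαX : ContinuousOn (fun c : ℝ × ℂ => α (l (τ + ρ * c.2)))
      (Icc (0 : ℝ) 1 ×ˢ closedBall (0 : ℂ) 1) := fun c hc =>
    ContinuousAt.comp_continuousWithinAt (f := fun c : ℝ × ℂ => l (τ + ρ * c.2))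
      (hB _ (hX c.2 (by simpa using hc.2))).1.continuousAt (hXc c hc)
  have hsX : ContinuousOn (fun c : ℝ × ℂ => s c.1 c.2)
      (Icc (0 : ℝ) 1 ×ˢ closedBall (0 : ℂ) 1) := by
    simp only [s]; fun_prop
  have hld : Differentiable ℂ (fun z : ℂ => l (τ + ρ * z)) := by
    simp only [l]; fun_prop
  have := hK.limit_disc_mem
    (G := fun c => l (τ + ρ * c.2) + (α (l (τ + ρ * c.2)) + s c.1 c.2) • v)
    (hXc.add ((hαX.add hsX).smul continuousOn_const))
    (fun t _ z hz => by
      refine DifferentiableAt.differentiableWithinAt ?_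
      have h1 : DifferentiableAt ℂ (fun z : ℂ => α (l (τ + ρ * z))) z :=
        DifferentiableAt.comp (f := fun z : ℂ => l (τ + ρ * z)) z
          (hB _ (hX z (by simpa using (mem_ball.1 hz).le))).1 (hld z)
      exact (hld z).add ((h1.add (by simp only [s]; fun_prop)).smul_const v))
    (fun t ht z hz => hmem t (Ico_subset_Icc_self ht) z (by simpa using hz) (Or.inl ht.2.ne))
    (fun z hz => hmem 1 (by simp) z (by simpa using (mem_sphere.1 hz).le)
      (Or.inr (by rintro rfl; simp at hz)))
  refine this.2 ?_
  have h5 := hτS.2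
  simpa [Φ, s] using h5

open Filter Topology in
theorem analyticOnNhd_slice {n : ℕ} {U : Set (Fin n → ℂ)} (hU : IsOpen U)
    {h : (Fin n → ℂ) → ℂ} (hh : DifferentiableOn ℂ h U) (x v : Fin n → ℂ) :
    AnalyticOnNhd ℂ (fun t : ℂ => h (x + t • v)) {t | x + t • v ∈ U} := by
  have hc : Continuous (fun t : ℂ => x + t • v) := by fun_prop
  refine DifferentiableOn.analyticOnNhd ?_ (hU.preimage hc)
  exact hh.comp (by fun_prop) (fun t ht => ht)

theorem deriv_slice {n : ℕ} {h : (Fin n → ℂ) → ℂ} {x v : Fin n → ℂ} {t : ℂ}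
    (hh : DifferentiableAt ℂ h (x + t • v)) :
    deriv (fun t : ℂ => h (x + t • v)) t = fderiv ℂ h (x + t • v) v := by
  have h1 : HasDerivAt (fun t : ℂ => x + t • v) v t := by
    simpa using ((hasDerivAt_id t).smul_const v).const_add x
  exact (hh.hasFDerivAt.comp_hasDerivAt t h1).deriv

open Filter Topology in
theorem eventually_forall_translate_mem {n : ℕ} {U : Set (Fin n → ℂ)} (hU : IsOpen U)
    {K : Set ℂ} (hK : IsCompact K) {x₀ v : Fin n → ℂ} (h : ∀ t ∈ K, x₀ + t • v ∈ U) :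
    ∀ᶠ x in 𝓝 x₀, ∀ t ∈ K, x + t • v ∈ U := by
  refine hK.eventually_forall_of_forall_eventually fun t ht => ?_
  have : Continuous (fun c : (Fin n → ℂ) × ℂ => c.1 + c.2 • v) := by fun_prop
  exact this.continuousAt.preimage_mem_nhds (hU.mem_nhds (h t ht))

open Filter Topology in
theorem differentiableOn_fderiv_apply {n : ℕ} {U : Set (Fin n → ℂ)} (hU : IsOpen U)
    {h : (Fin n → ℂ) → ℂ} (hh : DifferentiableOn ℂ h U) (v : Fin n → ℂ) :
    DifferentiableOn ℂ (fun y => fderiv ℂ h y v) U := by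
  intro y₀ hy₀
  refine DifferentiableAt.differentiableWithinAt ?_
  have hc : Continuous (fun t : ℂ => y₀ + t • v) := by fun_prop
  obtain ⟨ρ, hρ, hρU⟩ := Metric.nhds_basis_closedBall.mem_iff.1
    (hc.continuousAt.preimage_mem_nhds (hU.mem_nhds (by simpa using hy₀ : y₀ + (0 : ℂ) • v ∈ U)))
  have hev := eventually_forall_translate_mem hU (isCompact_closedBall (0 : ℂ) ρ)
    (x₀ := y₀) (v := v) (fun t ht => hρU ht)
  have hd := differentiableAt_circleIntegral_translate hU hh (κ := fun t => 1 / (t - 0) ^ 2)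
    (u := v) (x₀ := y₀) hρ.le (by
      refine continuousOn_const.div (by fun_prop) fun t ht => ?_
      have : t ≠ 0 := by rintro rfl; simp [hρ.ne] at ht
      simpa using this) (fun t ht => hρU (sphere_subset_closedBall ht))
  refine (hd.const_mul (2 * Real.pi * Complex.I)⁻¹).congr_of_eventuallyEq ?_
  filter_upwards [hev] with y hy
  have h1 :=
    ((analyticOnNhd_slice hU hh y v).differentiableOn.mono hy).deriv_eq_smul_circleIntegral hρ
  have h2 : h (y + (0 : ℂ) • v) = h y := by simp
  have h3 : DifferentiableAt ℂ h (y + (0 : ℂ) • v) :=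
    hh.differentiableAt (hU.mem_nhds (hy 0 (by simp [hρ.le])))
  rw [deriv_slice h3] at h1
  simp only [zero_smul, add_zero, smul_eq_mul] at h1
  rw [h1, inv_mul_cancel_left₀ Complex.two_pi_I_ne_zero]

open Filter Topology in
theorem exists_separating_radius (Z : Finset ℂ) {ρ : ℝ} (hZ : ∀ b ∈ Z, b ∈ ball (0 : ℂ) ρ) :
    ∃ ε > 0, (∀ b ∈ Z, closedBall b ε ⊆ ball (0 : ℂ) ρ) ∧
      ∀ b ∈ Z, ∀ b' ∈ Z, b ≠ b' → 2 * ε < dist b b' := by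
  have h1 : ∀ᶠ ε in 𝓝[>] (0 : ℝ), ∀ b ∈ Z, closedBall b ε ⊆ ball (0 : ℂ) ρ := by
    rw [Filter.eventually_all_finset]
    intro b hb
    have hb' : 0 < ρ - dist b 0 := by have := mem_ball.1 (hZ b hb); linarith
    filter_upwards [Ioo_mem_nhdsGT hb'] with ε hε z hz
    have := dist_triangle z b 0
    rw [mem_closedBall] at hz
    rw [mem_ball]
    linarith [hε.2]
  have h2 : ∀ᶠ ε in 𝓝[>] (0 : ℝ), ∀ b ∈ Z, ∀ b' ∈ Z, b ≠ b' → 2 * ε < dist b b' := by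
    rw [Filter.eventually_all_finset]
    intro b _
    rw [Filter.eventually_all_finset]
    intro b' _
    by_cases hbb : b = b'
    · simp [hbb]
    · filter_upwards [Ioo_mem_nhdsGT (half_pos (dist_pos.2 hbb))] with ε hε _
      linarith [hε.2]
  obtain ⟨ε, ⟨h3, h4⟩, h5⟩ := ((h1.and h2).and self_mem_nhdsWithin).exists
  exact ⟨ε, h5, h3, h4⟩

/-- The affine disc of radius `ρ` at `x` in direction `v` lies in `U`, and `h` has no zero on its
boundary. -/
def AdmissibleDisc {n : ℕ} (h : (Fin n → ℂ) → ℂ) (U : Set (Fin n → ℂ)) (v : Fin n → ℂ) (ρ : ℝ)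
    (x : Fin n → ℂ) : Prop :=
  (∀ t ∈ closedBall (0 : ℂ) ρ, x + t • v ∈ U) ∧ ∀ t ∈ sphere (0 : ℂ) ρ, h (x + t • v) ≠ 0

/-- The integral representing the `j`-th power sum of the zeros of `h` in an affine disc. -/
noncomputable def zeroMoment {n : ℕ} (h : (Fin n → ℂ) → ℂ) (v : Fin n → ℂ) (ρ : ℝ) (j : ℕ)
    (x : Fin n → ℂ) : ℂ :=
  (2 * Real.pi * Complex.I)⁻¹ *
    ∮ t in C(0, ρ), t ^ j * (fderiv ℂ h (x + t • v) v / h (x + t • v))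

section Moments

variable {n : ℕ} {U : Set (Fin n → ℂ)} {h : (Fin n → ℂ) → ℂ} {v : Fin n → ℂ} {ρ : ℝ}
  {x : Fin n → ℂ}

theorem isOpen_inter_ne_zero (hU : IsOpen U) (hh : DifferentiableOn ℂ h U) :
    IsOpen (U ∩ {y | h y ≠ 0}) :=
  hh.continuousOn.isOpen_inter_preimage hU isOpen_ne

open Filter Topology in
theorem AdmissibleDisc.eventually (hU : IsOpen U) (hh : DifferentiableOn ℂ h U)
    (hx : AdmissibleDisc h U v ρ x) : ∀ᶠ y in 𝓝 x, AdmissibleDisc h U v ρ y := by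
  filter_upwards [eventually_forall_translate_mem hU (isCompact_closedBall (0 : ℂ) ρ) hx.1,
    eventually_forall_translate_mem (isOpen_inter_ne_zero hU hh) (isCompact_sphere (0 : ℂ) ρ)
      (fun t ht => ⟨hx.1 t (sphere_subset_closedBall ht), hx.2 t ht⟩)] with y h1 h2
  exact ⟨h1, fun t ht => (h2 t ht).2⟩

theorem AdmissibleDisc.differentiableAt_zeroMoment (hU : IsOpen U) (hh : DifferentiableOn ℂ h U)
    (hρ : 0 < ρ) (hx : AdmissibleDisc h U v ρ x) (j : ℕ) :
    DifferentiableAt ℂ (zeroMoment h v ρ j) x := by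
  refine DifferentiableAt.const_mul ?_ _
  have hg : DifferentiableOn ℂ (fun y => fderiv ℂ h y v / h y) (U ∩ {y | h y ≠ 0}) := by
    simp only [div_eq_mul_inv]
    exact ((differentiableOn_fderiv_apply hU hh v).mono inter_subset_left).fun_mul
      ((hh.mono inter_subset_left).fun_inv fun _ hy => hy.2)
  exact differentiableAt_circleIntegral_translate (isOpen_inter_ne_zero hU hh) hg
    (κ := fun t => t ^ j) hρ.le (by fun_prop)
    (fun t ht => ⟨hx.1 t (sphere_subset_closedBall ht), hx.2 t ht⟩)

theorem AdmissibleDisc.exists_finset (hU : IsOpen U) (hh : DifferentiableOn ℂ h U)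
    (hρ : 0 < ρ) (hx : AdmissibleDisc h U v ρ x) :
    ∃ Z : Finset ℂ, ∀ z, z ∈ Z ↔ z ∈ ball (0 : ℂ) ρ ∧ h (x + z • v) = 0 := by
  have hs : (ρ : ℂ) ∈ sphere (0 : ℂ) ρ := by simp [abs_of_pos hρ]
  have hfin := finite_zeros_closedBall ((analyticOnNhd_slice hU hh x v).mono hx.1)
    (sphere_subset_closedBall hs) (hx.2 _ hs)
  have hfin' : {z ∈ ball (0 : ℂ) ρ | h (x + z • v) = 0}.Finite :=
    hfin.subset fun z hz => ⟨ball_subset_closedBall hz.1, hz.2⟩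
  exact ⟨hfin'.toFinset, fun z => by simp⟩

theorem AdmissibleDisc.zeroMoment_eq (hU : IsOpen U) (hh : DifferentiableOn ℂ h U)
    (hρ : 0 < ρ) (hx : AdmissibleDisc h U v ρ x) (Z : Finset ℂ)
    (hZ : ∀ z, z ∈ Z ↔ z ∈ ball (0 : ℂ) ρ ∧ h (x + z • v) = 0) :
    ∃ μ : ℂ → ℕ, (∀ a ∈ Z, μ a ≠ 0) ∧
      ∀ j : ℕ, zeroMoment h v ρ j x = ∑ a ∈ Z, (μ a : ℂ) * a ^ j := by
  obtain ⟨μ, hμ, hμj⟩ := circleIntegral_pow_mul_logDeriv hρ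
    ((analyticOnNhd_slice hU hh x v).mono hx.1) hx.2 Z hZ
  refine ⟨μ, hμ, fun j => ?_⟩
  rw [zeroMoment, ← inv_mul_cancel_left₀ Complex.two_pi_I_ne_zero
    (∑ a ∈ Z, (μ a : ℂ) * a ^ j), ← hμj j]
  congr 1
  refine circleIntegral.integral_congr hρ.le fun t ht => ?_
  rw [deriv_slice (hh.differentiableAt (hU.mem_nhds (hx.1 t (sphere_subset_closedBall ht))))]

open Filter Topology in
/-- Near a point over which the number of distinct zeros of `h` in an affine disc is maximal, the
zeros are holomorphic functions. -/
theorem AdmissibleDisc.exists_sheets (hU : IsOpen U) (hh : DifferentiableOn ℂ h U)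
    (hx : AdmissibleDisc h U v ρ x) (Z : Finset ℂ)
    (hZ : ∀ z, z ∈ Z ↔ z ∈ ball (0 : ℂ) ρ ∧ h (x + z • v) = 0)
    (hmax : ∀ᶠ y in 𝓝 x, ∀ T : Finset ℂ,
      (∀ z ∈ T, z ∈ ball (0 : ℂ) ρ ∧ h (y + z • v) = 0) → T.card ≤ Z.card) :
    ∃ α : ℂ → (Fin n → ℂ) → ℂ, (∀ b ∈ Z, α b x = b ∧ ∀ᶠ y in 𝓝 x, DifferentiableAt ℂ (α b) y) ∧
      ∀ᶠ y in 𝓝 x, ∀ w ∈ ball (0 : ℂ) ρ, (h (y + w • v) = 0 ↔ ∃ b ∈ Z, w = α b y) := by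
  classical
  obtain ⟨ε, hε, hεball, hεdisj⟩ := exists_separating_radius Z fun b hb => ((hZ b).1 hb).1
  have hadd : ∀ (y : Fin n → ℂ) (b t : ℂ), y + b • v + t • v = y + (b + t) • v := by
    intro y b t; module
  have hmemb : ∀ b t : ℂ, t ∈ closedBall (0 : ℂ) ε → b + t ∈ closedBall b ε := by
    intro b t ht; simpa using ht
  have hadm : ∀ b ∈ Z, AdmissibleDisc h U v ε (x + b • v) := by
    intro b hb
    refine ⟨fun t ht => ?_, fun t ht h0 => ?_⟩
    · rw [hadd]
      exact hx.1 _ (ball_subset_closedBall (hεball b hb (hmemb b t ht)))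
    · rw [hadd] at h0
      have h1 := hεball b hb (hmemb b t (sphere_subset_closedBall ht))
      have h2 := (hZ _).2 ⟨h1, h0⟩
      have ht' : ‖t‖ = ε := by simpa using ht
      have hne : b ≠ b + t := by
        intro h
        have : t = 0 := by simpa using h
        rw [this, norm_zero] at ht'
        linarith
      have := hεdisj b hb _ h2 hne
      rw [dist_self_add_right, ht'] at this
      linarith
  have hshift : ∀ b : ℂ, Continuous (fun y : Fin n → ℂ => y + b • v) := fun b => by fun_prop
  have hadm' : ∀ᶠ y in 𝓝 x, ∀ b ∈ Z, AdmissibleDisc h U v ε (y + b • v) := by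
    rw [Filter.eventually_all_finset]
    intro b hb
    exact (hshift b).continuousAt.eventually ((hadm b hb).eventually hU hh)
  have hdiff : ∀ b : ℂ, ∀ y, AdmissibleDisc h U v ε (y + b • v) → ∀ j,
      DifferentiableAt ℂ (fun y => zeroMoment h v ε j (y + b • v)) y := by
    intro b y hy j
    exact DifferentiableAt.comp (f := fun y : Fin n → ℂ => y + b • v) y
      (hy.differentiableAt_zeroMoment hU hh hε j) (by fun_prop)
  have hx0 : ∀ b ∈ Z, zeroMoment h v ε 0 (x + b • v) ≠ 0 := by
    intro b hb
    obtain ⟨T, hT⟩ := (hadm b hb).exists_finset hU hh hε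
    obtain ⟨μ, hμ, hμj⟩ := (hadm b hb).zeroMoment_eq hU hh hε T hT
    have h0T : (0 : ℂ) ∈ T := (hT 0).2 ⟨by simpa using hε, by
      rw [hadd, add_zero]; exact ((hZ b).1 hb).2⟩
    rw [hμj]
    simp only [pow_zero, mul_one]
    have : 0 < ∑ a ∈ T, μ a :=
      Finset.sum_pos' (fun _ _ => Nat.zero_le _) ⟨0, h0T, Nat.pos_of_ne_zero (hμ 0 h0T)⟩
    exact_mod_cast this.ne'
  have hne : ∀ᶠ y in 𝓝 x, ∀ b ∈ Z, zeroMoment h v ε 0 (y + b • v) ≠ 0 := by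
    rw [Filter.eventually_all_finset]
    intro b hb
    exact (hdiff b x (hadm b hb) 0).continuousAt.eventually_ne (hx0 b hb)
  have hroot : ∀ y, (∀ b ∈ Z, AdmissibleDisc h U v ε (y + b • v)) →
      (∀ b ∈ Z, zeroMoment h v ε 0 (y + b • v) ≠ 0) →
      (∀ T : Finset ℂ, (∀ z ∈ T, z ∈ ball (0 : ℂ) ρ ∧ h (y + z • v) = 0) → T.card ≤ Z.card) →
      ∀ w ∈ ball (0 : ℂ) ρ, (h (y + w • v) = 0 ↔ ∃ b ∈ Z, w = b +
        zeroMoment h v ε 1 (y + b • v) / zeroMoment h v ε 0 (y + b • v)) := by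
    intro y hy hy0 hymax
    choose! T hT using fun b hb => (hy b hb).exists_finset hU hh hε
    have hTne : ∀ b ∈ Z, ∃ a, a ∈ T b := by
      intro b hb
      by_contra! hcon
      obtain ⟨μ, -, hμj⟩ := (hy b hb).zeroMoment_eq hU hh hε (T b) (hT b hb)
      refine hy0 b hb ?_
      rw [hμj, Finset.eq_empty_of_forall_notMem hcon, Finset.sum_empty]
    choose! a ha using hTne
    have hab : ∀ b ∈ Z, a b ∈ ball (0 : ℂ) ε ∧ h (y + (b + a b) • v) = 0 := by
      intro b hb
      have := (hT b hb _).1 (ha b hb)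
      rwa [hadd] at this
    have hinj : ∀ b ∈ Z, ∀ b' ∈ Z, ∀ s ∈ ball (0 : ℂ) ε, ∀ s' ∈ ball (0 : ℂ) ε,
        b + s = b' + s' → b = b' := by
      intro b hb b' hb' s hs s' hs' heq
      by_contra hne
      have h1 := hεdisj b hb b' hb' hne
      have h2 : dist b b' = ‖s' - s‖ := by
        rw [dist_eq_norm]; congr 1; linear_combination heq
      have h3 := norm_sub_le s' s
      rw [mem_ball_zero_iff] at hs hs'
      linarith
    have hbr : ∀ b ∈ Z, ∀ s ∈ ball (0 : ℂ) ε, b + s ∈ ball (0 : ℂ) ρ := fun b hb s hs =>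
      hεball b hb (hmemb b s (ball_subset_closedBall hs))
    have hcard : (Z.image fun b => b + a b).card = Z.card := by
      refine Finset.card_image_of_injOn fun b hb b' hb' heq => ?_
      exact hinj b hb b' hb' _ (hab b hb).1 _ (hab b' hb').1 heq
    have hall : ∀ w ∈ ball (0 : ℂ) ρ, h (y + w • v) = 0 → ∃ b ∈ Z, w = b + a b := by
      intro w hw hw0
      by_contra! hcon
      have hnot : w ∉ Z.image fun b => b + a b := by
        simp only [Finset.mem_image, not_exists, not_and]
        exact fun b hb h => hcon b hb h.symm
      have := hymax (insert w (Z.image fun b => b + a b)) (by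
        intro z hz
        rcases Finset.mem_insert.1 hz with rfl | hz
        · exact ⟨hw, hw0⟩
        · obtain ⟨b, hb, rfl⟩ := Finset.mem_image.1 hz
          exact ⟨hbr b hb _ (hab b hb).1, (hab b hb).2⟩)
      rw [Finset.card_insert_of_notMem hnot, hcard] at this
      omega
    have hTsing : ∀ b ∈ Z, T b = {a b} := by
      intro b hb
      refine Finset.eq_singleton_iff_unique_mem.2 ⟨ha b hb, fun s hs => ?_⟩
      obtain ⟨hs1, hs2⟩ := (hT b hb s).1 hs
      rw [hadd] at hs2
      obtain ⟨b', hb', heq⟩ := hall _ (hbr b hb s hs1) hs2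
      obtain rfl := hinj b hb b' hb' s hs1 _ (hab b' hb').1 heq
      exact add_left_cancel heq
    have hval : ∀ b ∈ Z, zeroMoment h v ε 1 (y + b • v) / zeroMoment h v ε 0 (y + b • v) = a b := by
      intro b hb
      obtain ⟨μ, hμ, hμj⟩ := (hy b hb).zeroMoment_eq hU hh hε (T b) (hT b hb)
      have hμ0 : (μ (a b) : ℂ) ≠ 0 := by exact_mod_cast hμ _ (ha b hb)
      rw [hμj, hμj, hTsing b hb]
      simp only [Finset.sum_singleton, pow_one, pow_zero, mul_one]
      field_simp
    intro w hw
    constructor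
    · intro h0
      obtain ⟨b, hb, heq⟩ := hall w hw h0
      exact ⟨b, hb, by rw [hval b hb, heq]⟩
    · rintro ⟨b, hb, heq⟩
      rw [heq, hval b hb]
      exact (hab b hb).2
  refine ⟨fun b y => b + zeroMoment h v ε 1 (y + b • v) / zeroMoment h v ε 0 (y + b • v),
    fun b hb => ⟨?_, ?_⟩, ?_⟩
  · obtain ⟨T, hT⟩ := (hadm b hb).exists_finset hU hh hε
    obtain ⟨μ, hμ, hμj⟩ := (hadm b hb).zeroMoment_eq hU hh hε T hT
    have hT0 : ∀ s ∈ T, s = 0 := by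
      intro s hs
      obtain ⟨hs1, hs2⟩ := (hT s).1 hs
      rw [hadd] at hs2
      have h1 := (hZ _).2 ⟨hεball b hb (hmemb b s (ball_subset_closedBall hs1)), hs2⟩
      by_contra hs0
      have := hεdisj b hb _ h1 (by simpa using hs0)
      rw [dist_self_add_right] at this
      rw [mem_ball_zero_iff] at hs1
      linarith
    have : zeroMoment h v ε 1 (x + b • v) = 0 := by
      rw [hμj]
      exact Finset.sum_eq_zero fun s hs => by simp [hT0 s hs]
    simp [this]
  · filter_upwards [hadm', hne] with y hy1 hy2
    simp only [div_eq_mul_inv]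
    exact ((hdiff b y (hy1 b hb) 1).fun_mul
      ((hdiff b y (hy1 b hb) 0).fun_inv (hy2 b hb))).const_add b
  · filter_upwards [hadm', hne, hmax] with y hy1 hy2 hy3
    exact hroot y hy1 hy2 hy3

end Moments

theorem det_hankel_ne_zero {m : ℕ} {Z : Finset ℂ} {μ : ℂ → ℂ} (hμ : ∀ a ∈ Z, μ a ≠ 0)
    (hZ : Z.card = m) :
    (Matrix.of fun i j : Fin m => ∑ a ∈ Z, μ a * a ^ ((i : ℕ) + (j : ℕ))).det ≠ 0 := by
  let e : Fin m ≃ Z := (Z.equivFinOfCardEq hZ).symm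
  let z : Fin m → ℂ := fun i => e i
  have hfac : (Matrix.of fun i j : Fin m => ∑ a ∈ Z, μ a * a ^ ((i : ℕ) + (j : ℕ))) =
      (Matrix.vandermonde z).transpose * Matrix.diagonal (fun i => μ (z i)) *
        Matrix.vandermonde z := by
    ext i j
    rw [Matrix.mul_apply, Matrix.of_apply, ← Finset.sum_coe_sort Z, ← e.sum_comp]
    refine Finset.sum_congr rfl fun k _ => ?_
    rw [Matrix.mul_diagonal, Matrix.transpose_apply, Matrix.vandermonde_apply,
      Matrix.vandermonde_apply, pow_add]
    ring
  have hinj : Function.Injective z := Subtype.val_injective.comp e.injective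
  have hV : (Matrix.vandermonde z).det ≠ 0 := Matrix.det_vandermonde_ne_zero_iff.2 hinj
  rw [hfac, Matrix.det_mul, Matrix.det_mul, Matrix.det_transpose, Matrix.det_diagonal]
  exact mul_ne_zero (mul_ne_zero hV (Finset.prod_ne_zero_iff.2 fun i _ => hμ _ (e i).2)) hV

theorem det_hankel_eq_zero {m : ℕ} {Z : Finset ℂ} (μ : ℂ → ℂ) (hZ : Z.card < m) :
    (Matrix.of fun i j : Fin m => ∑ a ∈ Z, μ a * a ^ ((i : ℕ) + (j : ℕ))).det = 0 := by
  let P : Polynomial ℂ := ∏ a ∈ Z, (Polynomial.X - Polynomial.C a)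
  have hPm : P.Monic := Polynomial.monic_prod_of_monic _ _ fun a _ => Polynomial.monic_X_sub_C a
  have hPd : P.natDegree = Z.card := by
    rw [Polynomial.natDegree_prod_of_monic _ _ fun a _ => Polynomial.monic_X_sub_C a]
    simp
  have hP0 : ∀ a ∈ Z, P.eval a = 0 := by
    intro a ha
    rw [Polynomial.eval_prod]
    exact Finset.prod_eq_zero ha (by simp)
  refine Matrix.exists_mulVec_eq_zero_iff.1 ⟨fun j : Fin m => P.coeff j, ?_, ?_⟩
  · intro h0
    have h1 : P.coeff Z.card = 0 := congrFun h0 ⟨Z.card, hZ⟩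
    rw [← hPd, Polynomial.coeff_natDegree, hPm.leadingCoeff] at h1
    exact one_ne_zero h1
  · ext i
    simp only [Matrix.mulVec, dotProduct, Matrix.of_apply, Finset.sum_mul, Pi.zero_apply]
    rw [Finset.sum_comm]
    refine Finset.sum_eq_zero fun a ha => ?_
    have h2 := hP0 a ha
    rw [Polynomial.eval_eq_sum_range' (hPd ▸ hZ), ← Fin.sum_univ_eq_sum_range
      (fun j => P.coeff j * a ^ j)] at h2
    calc ∑ j : Fin m, μ a * a ^ ((i : ℕ) + (j : ℕ)) * P.coeff j
        = μ a * a ^ (i : ℕ) * ∑ j : Fin m, P.coeff j * a ^ (j : ℕ) := by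
          rw [Finset.mul_sum]
          refine Finset.sum_congr rfl fun j _ => ?_
          rw [pow_add]; ring
      _ = 0 := by rw [h2, mul_zero]

open Filter Topology in
/-- A holomorphic function on a convex open set which does not vanish at `y` has no zero near, and
distinct from, `p` on the line joining `p` to `y`. -/
theorem eventually_ne_zero_on_line {n : ℕ} {C : Set (Fin n → ℂ)} (hC : IsOpen C)
    (hCc : Convex ℝ C) {p y : Fin n → ℂ} {g : (Fin n → ℂ) → ℂ}
    (hg : DifferentiableOn ℂ g C) (hp : p ∈ C) (hy : y ∈ C) (hgy : g y ≠ 0) :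
    ∀ᶠ t : ℂ in 𝓝[≠] 0, g (p + t • (y - p)) ≠ 0 := by
  have han := analyticOnNhd_slice hC hg p (y - p)
  set S : Set ℂ := {t | p + t • (y - p) ∈ C}
  have h0 : (0 : ℂ) ∈ S := by simpa [S] using hp
  have h1 : (1 : ℂ) ∈ S := by simpa [S] using hy
  have hconv : Convex ℝ S := by
    intro a ha b hb s t hs ht hst
    have := hCc ha hb hs ht hst
    change p + (s • a + t • b) • (y - p) ∈ C
    convert this using 1
    rw [smul_add, smul_add, add_add_add_comm, ← add_smul, hst, one_smul, add_smul, smul_assoc,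
      smul_assoc]
  rcases (han 0 h0).eventually_eq_zero_or_eventually_ne_zero with h | h
  · exact absurd (by simpa using
      han.eqOn_zero_of_preconnected_of_eventuallyEq_zero hconv.isPreconnected h0 h h1) hgy
  · exact h

open Filter Topology in
theorem not_eventually_eq_zero {n : ℕ} {U : Set (Fin n → ℂ)} (hU : IsOpen U)
    {h : (Fin n → ℂ) → ℂ} (hh : DifferentiableOn ℂ h U) {p z : Fin n → ℂ}
    (hz : z ∈ connectedComponentIn U p) (hz0 : h z ≠ 0) : ¬∀ᶠ y in 𝓝 p, h y = 0 := by
  intro hp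
  have hpU : p ∈ U := by
    by_contra hp'
    rw [connectedComponentIn_eq_empty hp'] at hz
    exact hz
  have hsub : connectedComponentIn U p ⊆ {y | ∀ᶠ w in 𝓝 y, h w = 0} := by
    refine isPreconnected_connectedComponentIn.subset_of_closure_inter_subset
      isOpen_setOfPred_eventually_nhds ⟨p, mem_connectedComponentIn hpU, hp⟩ ?_
    rintro y ⟨hy, hyC⟩
    obtain ⟨R, hR, hRU⟩ := Metric.isOpen_iff.1 hU y (connectedComponentIn_subset U p hyC)
    obtain ⟨q, hqR, hq⟩ := mem_closure_iff.1 hy (ball y R) isOpen_ball (mem_ball_self hR)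
    refine Metric.eventually_nhds_iff_ball.2 ⟨R, hR, fun w hw => ?_⟩
    by_contra hw0
    have hne := eventually_ne_zero_on_line isOpen_ball (convex_ball y R) (hh.mono hRU) hqR hw hw0
    have hc : Tendsto (fun t : ℂ => q + t • (w - q)) (𝓝[≠] 0) (𝓝 q) := by
      have : Continuous (fun t : ℂ => q + t • (w - q)) := by fun_prop
      simpa using (this.tendsto 0).mono_left nhdsWithin_le_nhds
    obtain ⟨t, ht1, ht2⟩ := (hne.and (hc.eventually hq)).exists
    exact ht1 ht2
  exact hz0 (hsub hz).self_of_nhds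

open Filter Topology in
/-- Riemann's extension theorem for bounded functions holomorphic off the zero set of `s`. -/
theorem AdmissibleDisc.exists_extension {n : ℕ} {B : Set (Fin n → ℂ)} (hB : IsOpen B)
    {s F : (Fin n → ℂ) → ℂ} (hs : DifferentiableOn ℂ s B)
    (hF : ∀ x ∈ B, s x ≠ 0 → DifferentiableAt ℂ F x) {M : ℝ} (hFb : ∀ x ∈ B, ‖F x‖ ≤ M)
    {p u : Fin n → ℂ} {ρ : ℝ} (hρ : 0 < ρ) (hp : AdmissibleDisc s B u ρ p) :
    ∃ G : (Fin n → ℂ) → ℂ, ∀ᶠ x in 𝓝 p, DifferentiableAt ℂ G x ∧ (s x ≠ 0 → G x = F x) := by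
  have hFd : DifferentiableOn ℂ F (B ∩ {y | s y ≠ 0}) := fun y hy =>
    (hF y hy.1 hy.2).differentiableWithinAt
  refine ⟨fun x => (2 * Real.pi * Complex.I)⁻¹ * ∮ t in C(0, ρ), t⁻¹ * F (x + t • u), ?_⟩
  filter_upwards [hp.eventually hB hs] with x hx
  constructor
  · refine DifferentiableAt.const_mul ?_ _
    refine differentiableAt_circleIntegral_translate (isOpen_inter_ne_zero hB hs) hFd
      (κ := fun t => t⁻¹) hρ.le ?_
      (fun t ht => ⟨hx.1 t (sphere_subset_closedBall ht), hx.2 t ht⟩)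
    exact continuousOn_id.inv₀ fun t ht => ne_of_mem_sphere ht hρ.ne'
  · intro hsx
    obtain ⟨Z, hZ⟩ := hx.exists_finset hB hs hρ
    have hc : Continuous (fun t : ℂ => x + t • u) := by fun_prop
    have hdisc : ∀ t ∈ closedBall (0 : ℂ) ρ \ Z,
        DifferentiableAt ℂ (fun t : ℂ => F (x + t • u)) t := by
      intro t ht
      refine DifferentiableAt.comp (f := fun t : ℂ => x + t • u) t
        (hF _ (hx.1 t ht.1) fun h0 => ?_) (by fun_prop)
      by_cases htb : t ∈ ball (0 : ℂ) ρ
      · exact ht.2 ((hZ t).2 ⟨htb, h0⟩)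
      · rw [mem_ball, not_lt] at htb
        exact hx.2 t (mem_sphere.2 (le_antisymm ht.1 htb)) h0
    obtain ⟨g, hgc, hgd, hgZ⟩ := exists_continuousOn_closedBall_of_bounded_off_finite (r := ρ)
      (f := fun t : ℂ => F (x + t • u)) Z.finite_toSet (fun t ht => ((hZ t).1 ht).1)
      (fun t ht => (hdisc t ht).continuousAt.continuousWithinAt)
      (fun t ht => hdisc t ⟨ball_subset_closedBall ht.1, ht.2⟩) (by
        intro a ha
        refine ⟨M, eventually_map.2 (eventually_nhdsWithin_of_eventually_nhds ?_)⟩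
        filter_upwards [hc.continuousAt.preimage_mem_nhds
          (hB.mem_nhds (hx.1 a (ball_subset_closedBall ((hZ a).1 ha).1)))] with t ht
        exact hFb _ ht)
    have h0Z : (0 : ℂ) ∉ Z := fun h => hsx (by simpa using ((hZ 0).1 h).2)
    have hCauchy :=
      Complex.two_pi_I_inv_smul_circleIntegral_sub_inv_smul_of_differentiable_on_off_countable
        Z.countable_toSet (mem_ball_self hρ) hgc hgd
    rw [hgZ 0 h0Z, zero_smul, add_zero] at hCauchy
    rw [← hCauchy, smul_eq_mul]
    congr 1
    refine circleIntegral.integral_congr hρ.le fun t ht => ?_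
    have htZ : t ∉ Z := fun h => hx.2 t ht ((hZ t).1 h).2
    simp only [sub_zero, smul_eq_mul]
    rw [hgZ t htZ]

theorem differentiableAt_finset_prod {E ι : Type*} [NormedAddCommGroup E] [NormedSpace ℂ E]
    {u : Finset ι} {f : ι → E → ℂ} {x : E} (hf : ∀ i ∈ u, DifferentiableAt ℂ (f i) x) :
    DifferentiableAt ℂ (fun y => ∏ i ∈ u, f i y) x := by
  classical
  exact (HasFDerivAt.finsetProd fun i hi => (hf i hi).hasFDerivAt).differentiableAt

section LocalEquation

variable {n : ℕ} {Ω B : Set (Fin n → ℂ)} {h : (Fin n → ℂ) → ℂ} {v : Fin n → ℂ} {r : ℝ}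
  {Z : (Fin n → ℂ) → Finset ℂ}

open Filter Topology in
theorem AdmissibleDisc.eventually_ne (hΩ : IsOpen Ω) (hh : DifferentiableOn ℂ h Ω) (hr : 0 < r)
    {x : Fin n → ℂ} (hx : AdmissibleDisc h Ω v r x) : ∀ᶠ t : ℂ in 𝓝[≠] 0, h (x + t • v) ≠ 0 := by
  obtain ⟨T, hT⟩ := hx.exists_finset hΩ hh hr
  have hcl : IsClosed ((T.erase 0 : Finset ℂ) : Set ℂ) := (T.erase 0).finite_toSet.isClosed
  filter_upwards [self_mem_nhdsWithin, mem_nhdsWithin_of_mem_nhds (ball_mem_nhds (0 : ℂ) hr),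
    mem_nhdsWithin_of_mem_nhds (hcl.isOpen_compl.mem_nhds (by simp : (0 : ℂ) ∈ _))] with t h0 h1 h2
  exact fun h => h2 (by simpa using ⟨(hT t).2 ⟨h1, h⟩, h0⟩)

/-- A holomorphic function vanishing exactly where the number of distinct zeros of `h` in the
affine discs of radius `r` is not maximal. -/
theorem exists_discriminant (hΩ : IsOpen Ω) (hh : DifferentiableOn ℂ h Ω) (hr : 0 < r)
    (hB : ∀ x ∈ B, AdmissibleDisc h Ω v r x) (hBne : B.Nonempty)
    (hZ : ∀ x ∈ B, ∀ z, z ∈ Z x ↔ z ∈ ball (0 : ℂ) r ∧ h (x + z • v) = 0) {K : ℝ}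
    (hK : ∀ x ∈ B, ‖zeroMoment h v r 0 x‖ ≤ K) :
    ∃ (m : ℕ) (s : (Fin n → ℂ) → ℂ), DifferentiableOn ℂ s B ∧ (∃ x ∈ B, s x ≠ 0) ∧
      (∀ x ∈ B, (Z x).card ≤ m) ∧ ∀ x ∈ B, (s x ≠ 0 ↔ (Z x).card = m) := by
  have hcardK : ∀ x ∈ B, (Z x).card ≤ ⌊K⌋₊ := by
    intro x hx
    obtain ⟨μ, hμ, hμj⟩ := (hB x hx).zeroMoment_eq hΩ hh hr (Z x) (hZ x hx)
    refine Nat.le_floor (le_trans ?_ (hK x hx))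
    rw [hμj]
    simp only [pow_zero, mul_one]
    rw [← Nat.cast_sum, Complex.norm_natCast, Nat.cast_le, Finset.card_eq_sum_ones]
    exact Finset.sum_le_sum fun a ha => Nat.one_le_iff_ne_zero.2 (hμ a ha)
  obtain ⟨x₀, hx₀, hmax⟩ : ∃ x₀ ∈ B, ∀ x ∈ B, (Z x).card ≤ (Z x₀).card := by
    refine ⟨_, Function.argminOn_mem (fun x => ⌊K⌋₊ - (Z x).card) B hBne, fun x hx => ?_⟩
    have h1 := Function.argminOn_le (fun x => ⌊K⌋₊ - (Z x).card) B hx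
    have h2 := hcardK x hx
    omega
  have hs : ∀ x ∈ B, ((Matrix.of fun i j : Fin (Z x₀).card =>
      zeroMoment h v r ((i : ℕ) + (j : ℕ)) x).det ≠ 0 ↔ (Z x).card = (Z x₀).card) := by
    intro x hx
    obtain ⟨μ, hμ, hμj⟩ := (hB x hx).zeroMoment_eq hΩ hh hr (Z x) (hZ x hx)
    simp only [hμj]
    constructor
    · intro hdet
      by_contra hne
      exact hdet (det_hankel_eq_zero (fun a => (μ a : ℂ)) (lt_of_le_of_ne (hmax x hx) hne))
    · intro heq
      exact det_hankel_ne_zero (fun a ha => Nat.cast_ne_zero.2 (hμ a ha)) heq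
  refine ⟨(Z x₀).card, fun x => (Matrix.of fun i j : Fin (Z x₀).card =>
      zeroMoment h v r ((i : ℕ) + (j : ℕ)) x).det, fun x hx => ?_,
    ⟨x₀, hx₀, (hs x₀ hx₀).2 rfl⟩, hmax, hs⟩
  refine DifferentiableAt.differentiableWithinAt ?_
  simp only [Matrix.det_apply', Matrix.of_apply]
  refine DifferentiableAt.fun_sum fun σ _ => DifferentiableAt.const_mul ?_ _
  exact differentiableAt_finset_prod fun i _ =>
    (hB x hx).differentiableAt_zeroMoment hΩ hh hr _

open Filter Topology in
open scoped Classical in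
theorem differentiableAt_prod_zeros {W L : Set (Fin n → ℂ)} (hW : IsOpen W)
    (hLW : ∀ x ∈ W, x ∈ closure L → x ∈ L) (hK : SatisfiesKont (W \ L)) (hΩW : Ω ⊆ W)
    (hLh : ∀ x ∈ Ω, x ∈ L → h x = 0)
    (hΩ : IsOpen Ω) (hh : DifferentiableOn ℂ h Ω) (hBo : IsOpen B)
    (hB : ∀ x ∈ B, AdmissibleDisc h Ω v r x)
    (hZ : ∀ x ∈ B, ∀ z, z ∈ Z x ↔ z ∈ ball (0 : ℂ) r ∧ h (x + z • v) = 0)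
    {x₁ : Fin n → ℂ} (hx₁ : x₁ ∈ B) (hmax : ∀ x ∈ B, (Z x).card ≤ (Z x₁).card) :
    DifferentiableAt ℂ (fun x => ∏ a ∈ (Z x).filter (fun a => x + a • v ∈ L), -a) x₁ := by
  have hBn : ∀ᶠ x in 𝓝 x₁, x ∈ B := hBo.mem_nhds hx₁
  obtain ⟨α, hα, hsheet⟩ := (hB x₁ hx₁).exists_sheets hΩ hh (Z x₁) (hZ x₁ hx₁) (by
    filter_upwards [hBn] with y hy T hT
    exact (Finset.card_le_card fun z hz => (hZ y hy z).2 (hT z hz)).trans (hmax y hy))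
  obtain ⟨ε, hε, hεball, hεdisj⟩ :=
    exists_separating_radius (Z x₁) fun b hb => ((hZ x₁ hx₁ b).1 hb).1
  have hαc : ∀ b ∈ Z x₁, ContinuousAt (α b) x₁ := fun b hb =>
    (hα b hb).2.self_of_nhds.continuousAt
  have hclose : ∀ᶠ x in 𝓝 x₁, ∀ b ∈ Z x₁, dist (α b x) b < ε := by
    rw [Filter.eventually_all_finset]
    intro b hb
    have := (hαc b hb).eventually (ball_mem_nhds _ hε)
    rwa [(hα b hb).1] at this
  have hsep : ∀ x, (∀ b ∈ Z x₁, dist (α b x) b < ε) → ∀ b ∈ Z x₁, ∀ b' ∈ Z x₁,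
      dist (α b' x) b < ε → b = b' := by
    intro x hx b hb b' hb' hd
    by_contra hne
    have h1 := hεdisj b hb b' hb' hne
    have h2 := hx b' hb'
    have h3 := dist_triangle_left b b' (α b' x)
    linarith
  have hmemL : ∀ᶠ x in 𝓝 x₁, ∀ b ∈ Z x₁, (x + α b x • v ∈ L ↔ x₁ + b • v ∈ L) := by
    rw [Filter.eventually_all_finset]
    intro b hb
    have hbW : x₁ + b • v ∈ W :=
      hΩW ((hB x₁ hx₁).1 b (ball_subset_closedBall ((hZ x₁ hx₁ b).1 hb).1))
    by_cases hbL : x₁ + b • v ∈ L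
    · have := SatisfiesKont.eventually_graph_mem hW hLW hK (α := α b) (v := v) (hα b hb).2
        (by rwa [(hα b hb).1]) (by rwa [(hα b hb).1]) hε (by
          filter_upwards [hBn, hsheet, hclose] with x hxB hx hxc w hw hwL
          rw [(hα b hb).1] at hw
          have hwr : w ∈ ball (0 : ℂ) r := hεball b hb (ball_subset_closedBall hw)
          obtain ⟨b', hb', heq⟩ := (hx w hwr).1
            (hLh _ ((hB x hxB).1 w (ball_subset_closedBall hwr)) hwL)
          rw [heq, hsep x hxc b hb b' hb' (heq ▸ hw)])
      filter_upwards [this] with x hx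
      exact ⟨fun _ => hbL, fun _ => hx⟩
    · have hcl : x₁ + b • v ∈ (closure L)ᶜ := fun h => hbL (hLW _ hbW h)
      have hc : ContinuousAt (fun x => x + α b x • v) x₁ :=
        continuousAt_id.add ((hαc b hb).smul continuousAt_const)
      filter_upwards [hc.preimage_mem_nhds (isClosed_closure.isOpen_compl.mem_nhds
        (by rwa [(hα b hb).1]))] with x hx
      exact ⟨fun h => absurd (subset_closure h) hx, fun h => absurd h hbL⟩
  have hprod : ∀ᶠ x in 𝓝 x₁, ∏ a ∈ (Z x).filter (fun a => x + a • v ∈ L), -a =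
      ∏ b ∈ (Z x₁).filter (fun b => x₁ + b • v ∈ L), -α b x := by
    filter_upwards [hBn, hsheet, hclose, hmemL] with x hxB hx hxc hxL
    have hαr : ∀ b ∈ Z x₁, α b x ∈ ball (0 : ℂ) r := fun b hb =>
      hεball b hb (ball_subset_closedBall (hxc b hb))
    have himage : (Z x).filter (fun a => x + a • v ∈ L) =
        ((Z x₁).filter (fun b => x₁ + b • v ∈ L)).image (fun b => α b x) := by
      ext w
      simp only [Finset.mem_filter, Finset.mem_image]
      constructor
      · rintro ⟨hw, hwL⟩
        obtain ⟨hwr, hw0⟩ := (hZ x hxB w).1 hw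
        obtain ⟨b, hb, rfl⟩ := (hx w hwr).1 hw0
        exact ⟨b, ⟨hb, (hxL b hb).1 hwL⟩, rfl⟩
      · rintro ⟨b, ⟨hb, hbL⟩, rfl⟩
        exact ⟨(hZ x hxB _).2 ⟨hαr b hb, (hx _ (hαr b hb)).2 ⟨b, hb, rfl⟩⟩, (hxL b hb).2 hbL⟩
    rw [himage, Finset.prod_image]
    intro b hb b' hb' heq
    have hb := (Finset.mem_filter.1 hb).1
    refine hsep x hxc b hb b' (Finset.mem_filter.1 hb').1 ?_
    rw [← show α b x = α b' x from heq]
    exact hxc b hb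
  refine DifferentiableAt.congr_of_eventuallyEq ?_ hprod
  exact differentiableAt_finset_prod fun b hb =>
    ((hα b (Finset.mem_filter.1 hb).1).2.self_of_nhds).fun_neg

end LocalEquation

section LocalEquation

variable {n : ℕ} {W L Ω : Set (Fin n → ℂ)} {h : (Fin n → ℂ) → ℂ} {v p : Fin n → ℂ} {r δ : ℝ}

open Filter Topology in
/-- A pseudoconcave subset of the zero set of `h` is locally the zero set of a holomorphic function:
the (extension of the) product over the points of the subset in the affine discs in direction
`v`. -/
theorem SatisfiesKont.exists_defining_function (hW : IsOpen W)
    (hLW : ∀ x ∈ W, x ∈ closure L → x ∈ L) (hK : SatisfiesKont (W \ L)) (hΩW : Ω ⊆ W)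
    (hLh : ∀ x ∈ Ω, x ∈ L → h x = 0)
    (hΩ : IsOpen Ω) (hh : DifferentiableOn ℂ h Ω) (hr : 0 < r) (hr1 : r ≤ 1) (hδ : 0 < δ)
    (hp : ∀ t ∈ closedBall (0 : ℂ) r, p + t • v ∈ Ω)
    (hann : ∀ t ∈ closedBall (0 : ℂ) r, r - δ ≤ ‖t‖ → h (p + t • v) ≠ 0) :
    ∃ G : (Fin n → ℂ) → ℂ, ∀ᶠ x in 𝓝 p, DifferentiableAt ℂ G x ∧ (G x = 0 ↔ x ∈ L) := by
  classical
  have hsph : sphere (0 : ℂ) r ⊆ {t ∈ closedBall (0 : ℂ) r | r - δ ≤ ‖t‖} := by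
    intro t ht
    refine ⟨sphere_subset_closedBall ht, ?_⟩
    rw [mem_sphere_zero_iff_norm.1 ht]
    linarith
  have hA : IsCompact {t ∈ closedBall (0 : ℂ) r | r - δ ≤ ‖t‖} :=
    (isCompact_closedBall (0 : ℂ) r).inter_right (isClosed_le continuous_const continuous_norm)
  have hadmp : AdmissibleDisc h Ω v r p := ⟨hp, fun t ht => hann t (hsph ht).1 (hsph ht).2⟩
  have hM : ∀ᶠ x in 𝓝 p, ‖zeroMoment h v r 0 x‖ < ‖zeroMoment h v r 0 p‖ + 1 :=
    (hadmp.differentiableAt_zeroMoment hΩ hh hr 0).continuousAt.norm.eventually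
      (gt_mem_nhds (lt_add_one _))
  obtain ⟨R, hR, hB⟩ := Metric.eventually_nhds_iff_ball.1
    ((hadmp.eventually hΩ hh).and ((eventually_forall_translate_mem (isOpen_inter_ne_zero hΩ hh) hA
      (x₀ := p) (v := v) fun t ht => ⟨hp t ht.1, hann t ht.1 ht.2⟩).and hM))
  set B := ball p R with hBdef
  have hBo : IsOpen B := isOpen_ball
  have hadm : ∀ x ∈ B, AdmissibleDisc h Ω v r x := fun x hx => (hB x hx).1
  have hannB : ∀ x ∈ B, ∀ t ∈ closedBall (0 : ℂ) r, r - δ ≤ ‖t‖ → h (x + t • v) ≠ 0 :=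
    fun x hx t ht htδ => ((hB x hx).2.1 t ⟨ht, htδ⟩).2
  have hBΩ : B ⊆ Ω := fun x hx => by simpa using (hadm x hx).1 0 (by simpa using hr.le)
  choose! Z hZ using fun x hx => (hadm x hx).exists_finset hΩ hh hr
  obtain ⟨m, s, hs, ⟨x₀, hx₀, hsx₀⟩, hcard, hsm⟩ := exists_discriminant hΩ hh hr hadm
    ⟨p, mem_ball_self hR⟩ hZ (fun x hx => (hB x hx).2.2.le)
  set F : (Fin n → ℂ) → ℂ := fun x => ∏ a ∈ (Z x).filter (fun a => x + a • v ∈ L), -a with hF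
  have hFL : ∀ x ∈ B, (F x = 0 ↔ x ∈ L) := by
    intro x hx
    rw [hF, Finset.prod_eq_zero_iff]
    constructor
    · rintro ⟨a, ha, ha0⟩
      rw [neg_eq_zero] at ha0
      simpa [ha0] using (Finset.mem_filter.1 ha).2
    · intro hxL
      refine ⟨0, Finset.mem_filter.2 ⟨(hZ x hx 0).2 ⟨mem_ball_self hr, ?_⟩, by simpa using hxL⟩,
        neg_zero⟩
      simpa using hLh x (hBΩ hx) hxL
  have hFb : ∀ x ∈ B, ‖F x‖ ≤ 1 := by
    intro x hx
    rw [hF, norm_prod]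
    refine Finset.prod_le_one (fun _ _ => norm_nonneg _) fun a ha => ?_
    have := mem_ball_zero_iff.1 ((hZ x hx a).1 (Finset.mem_filter.1 ha).1).1
    rw [norm_neg]
    linarith
  have hFd : ∀ x ∈ B, s x ≠ 0 → DifferentiableAt ℂ F x := by
    intro x hx hsx
    refine differentiableAt_prod_zeros hW hLW hK hΩW hLh hΩ hh hBo hadm hZ hx fun y hy => ?_
    rw [(hsm x hx).1 hsx]
    exact hcard y hy
  have hshift : ∀ x ∈ B, s x ≠ 0 → ∀ c : ℂ, ‖c‖ < δ → x + c • v ∈ B → s (x + c • v) ≠ 0 := by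
    intro x hx hsx c hc hxc
    refine (hsm _ hxc).2 (le_antisymm (hcard _ hxc) ?_)
    rw [← (hsm x hx).1 hsx]
    refine Finset.card_le_card_of_injOn (fun a => a - c) (fun a ha => ?_)
      (sub_left_injective.injOn)
    obtain ⟨har, ha0⟩ := (hZ x hx a).1 ha
    have hal : ‖a‖ < r - δ := by
      by_contra! hcon
      exact hannB x hx a (ball_subset_closedBall har) hcon ha0
    refine (hZ _ hxc _).2 ⟨?_, ?_⟩
    · rw [mem_ball_zero_iff]
      have := norm_sub_le a c
      linarith
    · rwa [add_assoc, ← add_smul, add_sub_cancel]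
  set u := x₀ - p with hu
  obtain ⟨ρ, hρ, hρp⟩ : ∃ ρ > 0, AdmissibleDisc s B u ρ p := by
    have h1 := eventually_ne_zero_on_line hBo (convex_ball p R) hs (mem_ball_self hR) hx₀ hsx₀
    rw [eventually_nhdsWithin_iff] at h1
    have hc : Continuous (fun t : ℂ => p + t • u) := by fun_prop
    have h2 : ∀ᶠ t : ℂ in 𝓝 0, p + t • u ∈ B :=
      hc.continuousAt.preimage_mem_nhds (hBo.mem_nhds (by
        rw [zero_smul, add_zero]; exact mem_ball_self hR))
    obtain ⟨ρ, hρ, hρs⟩ := Metric.nhds_basis_closedBall.mem_iff.1 (h1.and h2)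
    exact ⟨ρ, hρ, fun t ht => (hρs ht).2, fun t ht =>
      (hρs (sphere_subset_closedBall ht)).1 (ne_of_mem_sphere ht hρ.ne')⟩
  obtain ⟨G, hG⟩ := hρp.exists_extension hBo hs hFd hFb hρ
  refine ⟨G, ?_⟩
  filter_upwards [hG.eventually_nhds, hBo.mem_nhds (mem_ball_self hR), hρp.eventually hBo hs]
    with x hGx hxB hρx
  refine ⟨hGx.self_of_nhds.1, ?_⟩
  by_cases hsx : s x = 0
  swap
  · rw [hGx.self_of_nhds.2 hsx, hFL x hxB]
  have hGc : ContinuousAt G x := hGx.self_of_nhds.1.continuousAt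
  have hsu := hρx.eventually_ne hBo hs hρ
  have hxW : x ∈ W := hΩW (hBΩ hxB)
  have hBx : ∀ᶠ y in 𝓝 x, y ∈ B := hBo.mem_nhds hxB
  constructor
  · intro hGx0
    by_contra hxL
    have hc : Continuous (fun c : (Fin n → ℂ) × ℂ => c.1 + c.2 • v) := by fun_prop
    have hnear : ∀ᶠ c : (Fin n → ℂ) × ℂ in 𝓝 x ×ˢ 𝓝 0, c.1 + c.2 • v ∉ L := by
      rw [← nhds_prod_eq]
      filter_upwards [hc.continuousAt.preimage_mem_nhds (isClosed_closure.isOpen_compl.mem_nhds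
        (by simpa using fun h => hxL (hLW x hxW h) : x + (0 : ℂ) • v ∈ (closure L)ᶜ))] with c hc hcL
      exact hc (subset_closure hcL)
    obtain ⟨P, hP, Q, hQ, hPQ⟩ := Filter.eventually_prod_iff.1 hnear
    obtain ⟨η, hη, hηQ⟩ := Metric.eventually_nhds_iff_ball.1 hQ
    have hη' : 0 < min η 1 := lt_min hη one_pos
    have hlow : ∀ᶠ y in 𝓝 x, s y ≠ 0 → min η 1 ^ m ≤ ‖G y‖ := by
      filter_upwards [hGx, hP, hBx] with y hGy hPy hyB hsy
      rw [hGy.2 hsy, hF, norm_prod]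
      calc min η 1 ^ m ≤ min η 1 ^ ((Z y).filter (fun a => y + a • v ∈ L)).card :=
            pow_le_pow_of_le_one hη'.le (min_le_right _ _)
              ((Finset.card_filter_le _ _).trans (hcard y hyB))
        _ ≤ _ := by
            rw [← Finset.prod_const]
            refine Finset.prod_le_prod (fun _ _ => hη'.le) fun a ha => ?_
            rw [norm_neg]
            by_contra! hlt
            exact hPQ hPy (hηQ a (mem_ball_zero_iff.2 (hlt.trans_le (min_le_left _ _))))
              (Finset.mem_filter.1 ha).2
    have ht : Tendsto (fun z : ℂ => x + z • u) (𝓝[≠] 0) (𝓝 x) := by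
      have : Continuous (fun z : ℂ => x + z • u) := by fun_prop
      simpa using (this.tendsto 0).mono_left nhdsWithin_le_nhds
    have := ge_of_tendsto (hGc.norm.tendsto.comp ht) (by
      filter_upwards [ht.eventually hlow, hsu] with z h1 h2 using h1 h2)
    rw [hGx0, norm_zero] at this
    exact absurd this (not_le.2 (pow_pos hη' m))
  · intro hxL
    by_contra hGx0
    refine hK.not_isolated hW (x := x) (u := u) (v := v) hxW hxL ?_
    have hoff : ∀ᶠ y in 𝓝 x, s y ≠ 0 → y ∉ L := by
      filter_upwards [hGx, hBx, hGc.eventually_ne hGx0] with y hGy hyB hy0 hsy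
      rwa [← hFL y hyB, ← hGy.2 hsy]
    have hv := (hadm x hxB).eventually_ne hΩ hh hr
    have hvΩ : ∀ᶠ c : ℂ in 𝓝 0, x + c • v ∈ Ω := by
      have : Continuous (fun c : ℂ => x + c • v) := by fun_prop
      exact this.continuousAt.preimage_mem_nhds (hΩ.mem_nhds (by simpa using hBΩ hxB))
    have hcu : Tendsto (fun c : ℂ × ℂ => x + c.1 • u) (𝓝 0) (𝓝 x) := by
      have : Continuous (fun c : ℂ × ℂ => x + c.1 • u) := by fun_prop
      simpa using this.tendsto 0
    have hcuv : Tendsto (fun c : ℂ × ℂ => x + c.1 • u + c.2 • v) (𝓝 0) (𝓝 x) := by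
      have : Continuous (fun c : ℂ × ℂ => x + c.1 • u + c.2 • v) := by fun_prop
      simpa using this.tendsto 0
    have hfst : Tendsto (Prod.fst : ℂ × ℂ → ℂ) (𝓝 0) (𝓝 0) := continuous_fst.tendsto 0
    have hsnd : Tendsto (Prod.snd : ℂ × ℂ → ℂ) (𝓝 0) (𝓝 0) := continuous_snd.tendsto 0
    rw [eventually_nhdsWithin_iff] at hv hsu ⊢
    filter_upwards [hfst.eventually hsu, hsnd.eventually hv, hsnd.eventually hvΩ,
      hsnd.eventually (ball_mem_nhds _ hδ), hcu.eventually hBx, hcuv.eventually hBx,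
      hcuv.eventually hoff] with c h1 h2 h3 h4 h5 h6 h7 hc
    by_cases hc1 : c.1 = 0
    · have hc2 : c.2 ≠ 0 := fun hc2 => hc (Prod.ext hc1 hc2)
      rw [hc1, zero_smul, add_zero]
      exact fun hcL => h2 hc2 (hLh _ h3 hcL)
    · exact h7 (hshift _ h5 (h1 hc1) _ (mem_ball_zero_iff.1 h4) h6)

end LocalEquation

open Filter Topology in
/-- A pseudoconcave subset of a hypersurface is a hypersurface. -/
theorem PseudoconcaveIn.isHypersurfaceIn {n : ℕ} {V L L' : Set (Fin n → ℂ)}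
    (hL : PseudoconcaveIn L V) (hLV : L ⊆ V) (hLclosed : ∀ x ∈ V, x ∈ closure L → x ∈ L)
    (hL' : IsHypersurfaceIn L' V) (hLL' : L ⊆ L') : IsHypersurfaceIn L V := by
  refine ⟨hLV, hLclosed, fun p hpL => ?_⟩
  obtain ⟨W, hW, hWV, hpW, hK⟩ := hL p hpL
  obtain ⟨U₀, hU₀, -, hpU₀, h, hh, hcomp, hL'U₀⟩ := hL'.2.2 p (hLL' hpL)
  set Ω := U₀ ∩ W
  have hΩ : IsOpen Ω := hU₀.inter hW
  have hhΩ : DifferentiableOn ℂ h Ω := hh.mono inter_subset_left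
  have hLh : ∀ x ∈ Ω, x ∈ L → h x = 0 := fun x hx hxL =>
    (hL'U₀.subset ⟨hLL' hxL, hx.1⟩ : x ∈ {z ∈ U₀ | h z = 0}).2
  obtain ⟨z, hz, hz0⟩ := hcomp p hpU₀
  obtain ⟨R, hR, hRΩ⟩ := Metric.isOpen_iff.1 hΩ p ⟨hpU₀, hpW⟩
  obtain ⟨y, hy, hyR⟩ := ((not_eventually.1 (not_eventually_eq_zero hU₀ hh hz hz0)).and_eventually
    (ball_mem_nhds p hR)).exists
  have hline := eventually_ne_zero_on_line isOpen_ball (convex_ball p R) (hhΩ.mono hRΩ)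
    (mem_ball_self hR) hyR hy
  set v := y - p
  have hc : Continuous (fun t : ℂ => p + t • v) := by fun_prop
  have hlineΩ : ∀ᶠ t : ℂ in 𝓝 0, p + t • v ∈ Ω :=
    hc.continuousAt.preimage_mem_nhds (hΩ.mem_nhds (by simpa using ⟨hpU₀, hpW⟩))
  have hline' := hline
  rw [eventually_nhdsWithin_iff] at hline'
  obtain ⟨r₀, hr₀, hr₀s⟩ := Metric.nhds_basis_closedBall.mem_iff.1 (hline'.and hlineΩ)
  have hr : 0 < min r₀ 1 := lt_min hr₀ one_pos
  have hsub : closedBall (0 : ℂ) (min r₀ 1) ⊆ closedBall 0 r₀ :=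
    closedBall_subset_closedBall (min_le_left _ _)
  obtain ⟨G, hG⟩ := hK.exists_defining_function hW (fun x hx => hLclosed x (hWV hx))
    inter_subset_right hLh hΩ hhΩ hr (min_le_right _ _) (half_pos hr)
    (fun t ht => (hr₀s (hsub ht)).2) (fun t ht htδ => (hr₀s (hsub ht)).1 (by
      rintro rfl
      rw [norm_zero] at htδ
      linarith))
  obtain ⟨R', hR', hball⟩ := Metric.eventually_nhds_iff_ball.1
    (hG.and (hΩ.mem_nhds (⟨hpU₀, hpW⟩ : p ∈ Ω)))
  refine ⟨ball p R', isOpen_ball, fun x hx => hWV (hball x hx).2.2, mem_ball_self hR', G,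
    fun x hx => (hball x hx).1.1.differentiableWithinAt, fun q hq => ?_, ?_⟩
  · rw [(convex_ball p R').isPreconnected.connectedComponentIn hq]
    have hlineR : ∀ᶠ t : ℂ in 𝓝[≠] 0, p + t • v ∈ ball p R' :=
      mem_nhdsWithin_of_mem_nhds (hc.continuousAt.preimage_mem_nhds
        (isOpen_ball.mem_nhds (by simpa using hR')))
    obtain ⟨t, ht0, htR⟩ := (hline.and hlineR).exists
    exact ⟨_, htR, fun h0 => ht0 (hLh _ (hball _ htR).2 ((hball _ htR).1.2.1 h0))⟩
  · ext x
    exact ⟨fun hx => ⟨hx.2, (hball x hx.2).1.2.2 hx.1⟩,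
      fun hx => ⟨(hball x hx.1).1.2.1 hx.2, hx.1⟩⟩

/-- (Lemma 4.3 of the paper.)  If `V ⊆ ℂⁿ` is open, `L ⊆ V` is closed in `V`
and pseudoconcave in `V`, and `L` is contained in a hypersurface `L'` of `V`, then `L` is
itself a hypersurface of `V`. -/
theorem stmt13 {n : ℕ} (V L L' : Set (Fin n → ℂ)) (hV : IsOpen V)
    (hLV : L ⊆ V) (hLclosed : ∀ x ∈ V, x ∈ closure L → x ∈ L)
    (hL : PseudoconcaveIn L V)
    (hL' : IsHypersurfaceIn L' V) (hLL' : L ⊆ L') :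
    IsHypersurfaceIn L V := by
  exact hL.isHypersurfaceIn hLV hLclosed hL' hLL'
end
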